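/- arXiv:2307.11372 — 3 statements merged into one kernel-verified Lean document; each statement's English description precedes it below -/
import Mathlib

section
/- Let Φ : 𝒫_ℚ → 𝒫 be a support-preserving multiplicative map. Then there exists a real constant γ > 0 such that for every p ∈ 𝒫_ℚ, Φ[p] is the polynomial x ↦ p(γx)/p(γ). -/
open Polynomial

/-- `Pset` is the set of real polynomials with nonnegative coefficients summing to 1. -/
def Pset : Set (Polynomial ℝ) := {p | (∀ k, 0 ≤ p.coeff k) ∧ p.eval 1 = 1}

/-- `PQset` is the subset of `Pset` of polynomials with rational coefficients. -/
def PQset : Set (Polynomial ℝ) := {p | p ∈ Pset ∧ ∀ k : ℕ, ∃ r : ℚ, p.coeff k = (r : ℝ)}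

/-- Rational polynomials with nonnegative coefficients and constant term `1`. -/
def UnitCone : Submonoid ℚ[X] where
  carrier := {p | (∀ k, 0 ≤ p.coeff k) ∧ p.coeff 0 = 1}
  one_mem' := by
    refine ⟨fun k => ?_, by simp⟩
    rw [coeff_one]; positivity
  mul_mem' := by
    rintro p q ⟨hp, hp0⟩ ⟨hq, hq0⟩
    refine ⟨fun k => ?_, by simp [mul_coeff_zero, hp0, hq0]⟩
    rw [coeff_mul]
    exact Finset.sum_nonneg fun x _ => mul_nonneg (hp _) (hq _)

theorem mem_unitCone {p : ℚ[X]} : p ∈ UnitCone ↔ (∀ k, 0 ≤ p.coeff k) ∧ p.coeff 0 = 1 :=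
  Iff.rfl

theorem one_add_monomial_mem_unitCone {c : ℚ} (hc : 0 ≤ c) {j : ℕ} (hj : 1 ≤ j) :
    1 + C c * X ^ j ∈ UnitCone := by
  refine ⟨fun k => ?_, ?_⟩
  · simp only [coeff_add, coeff_one, coeff_C_mul, coeff_X_pow]
    split_ifs <;> positivity
  · simp [coeff_X_pow, show 0 ≠ j by omega]

/-- A common multiplier turning two congruent elements of the cone into elements
of the cone whose coefficients of index `1, …, K - 1` vanish. -/
theorem exists_common_multiplier {p q : ℚ[X]} (hp : p ∈ UnitCone) (hq : q ∈ UnitCone) {K : ℕ}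
    (hK : 1 ≤ K) (hpq : X ^ K ∣ p - q) :
    ∃ u : ℚ[X], p * u ∈ UnitCone ∧ q * u ∈ UnitCone ∧ X ^ K ∣ p * u - 1 ∧ X ^ K ∣ q * u - 1 := by
  set t : ℚ[X] := ∑ i ∈ Finset.range K, (1 - p) ^ i with ht
  have hpt : X ^ K ∣ p * t - 1 := by
    have h1 : p * t - 1 = -(1 - p) ^ K := by
      have := mul_neg_geom_sum (1 - p) K
      rw [← ht] at this
      linear_combination this
    have h2 : (X : ℚ[X]) ∣ 1 - p := by rw [X_dvd_iff]; simp [hp.2]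
    rw [h1, dvd_neg]
    exact pow_dvd_pow_of_dvd h2 K
  have hqt : X ^ K ∣ q * t - 1 := by
    have : q * t - 1 = (p * t - 1) - (p - q) * t := by ring
    rw [this]
    exact dvd_sub hpt (hpq.mul_right _)
  set m := (p * t).natDegree + (q * t).natDegree + 1 with hm
  set M : ℚ := ∑ i ∈ Finset.range m, (|(p * t).coeff i| + |(q * t).coeff i|) with hM
  have hM0 : 0 ≤ M := Finset.sum_nonneg fun i _ => by positivity
  have hMle : ∀ i < m, |(p * t).coeff i| + |(q * t).coeff i| ≤ M := fun i hi =>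
    Finset.single_le_sum (f := fun i => |(p * t).coeff i| + |(q * t).coeff i|)
      (fun i _ => by positivity) (Finset.mem_range.2 hi)
  set s : ℚ[X] := ∑ l ∈ Finset.range m, X ^ l with hs
  have key : ∀ r : ℚ[X], r ∈ UnitCone → X ^ K ∣ r * t - 1 → (r * t).natDegree < m →
      (∀ i < m, |(r * t).coeff i| ≤ M) →
      r * (t + X ^ K * (C M * s)) ∈ UnitCone ∧ X ^ K ∣ r * (t + X ^ K * (C M * s)) - 1 := by
    intro r hr hrt hdeg hbd
    have hdvd : X ^ K ∣ r * (t + X ^ K * (C M * s)) - 1 := by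
      have : r * (t + X ^ K * (C M * s)) - 1 = (r * t - 1) + X ^ K * (r * (C M * s)) := by ring
      rw [this]
      exact dvd_add hrt (dvd_mul_right _ _)
    refine ⟨?_, hdvd⟩
    have hlow : ∀ i < K, (r * (t + X ^ K * (C M * s))).coeff i = (1 : ℚ[X]).coeff i := by
      intro i hi
      have := X_pow_dvd_iff.1 hdvd i hi
      rw [coeff_sub] at this
      linarith
    refine ⟨fun i => ?_, by rw [hlow 0 (by omega)]; simp⟩
    rcases lt_or_ge i K with hi | hi
    · rw [hlow i hi]; exact (one_mem UnitCone : (1 : ℚ[X]) ∈ UnitCone).1 i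
    obtain ⟨i', rfl⟩ := Nat.exists_eq_add_of_le hi
    have hexp : r * (t + X ^ K * (C M * s)) = r * t + C M * (r * s) * X ^ K := by ring
    have hco : (r * s).coeff i' = ∑ l ∈ Finset.range m, (r * X ^ l).coeff i' := by
      rw [hs, Finset.mul_sum, finsetSum_coeff]
    have hterm : ∀ l, 0 ≤ (r * X ^ l).coeff i' := fun l => by
      rw [coeff_mul_X_pow']; split_ifs
      · exact hr.1 _
      · exact le_rfl
    rw [hexp, coeff_add, add_comm K i', coeff_mul_X_pow, coeff_C_mul, hco]
    rcases lt_or_ge (i' + K) m with h | h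
    · have h1 : (1 : ℚ) ≤ ∑ l ∈ Finset.range m, (r * X ^ l).coeff i' := by
        have := Finset.single_le_sum (f := fun l => (r * X ^ l).coeff i') (fun l _ => hterm l)
          (Finset.mem_range.2 (show i' < m by omega))
        refine le_trans (le_of_eq ?_) this
        simp [coeff_mul_X_pow', hr.2]
      have h2 := abs_le.1 (hbd _ h)
      nlinarith [h2.1]
    · rw [coeff_eq_zero_of_natDegree_lt (by omega : (r * t).natDegree < i' + K), zero_add]
      exact mul_nonneg hM0 (Finset.sum_nonneg fun l _ => hterm l)
  have h1 := key p hp hpt (by omega) fun i hi =>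
    le_trans (le_add_of_nonneg_right (abs_nonneg _)) (hMle i hi)
  have h2 := key q hq hqt (by omega) fun i hi =>
    le_trans (le_add_of_nonneg_left (abs_nonneg _)) (hMle i hi)
  exact ⟨_, h1.1, h2.1, h1.2, h2.2⟩

/-- Two polynomials whose logarithmic derivatives first differ at index `n` first differ at
index `n + 1`. -/
theorem coeff_eq_of_logDeriv {A B : ℚ[X]} {G H : PowerSeries ℚ} {n : ℕ}
    (hA0 : A.coeff 0 = 1) (hB0 : B.coeff 0 = 1)
    (hA : (derivative A : PowerSeries ℚ) = A * G) (hB : (derivative B : PowerSeries ℚ) = B * H)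
    (hlt : ∀ m < n, PowerSeries.coeff m G = PowerSeries.coeff m H)
    (hn : PowerSeries.coeff n G ≠ PowerSeries.coeff n H) :
    (∀ i < n + 1, A.coeff i = B.coeff i) ∧ A.coeff (n + 1) ≠ B.coeff (n + 1) := by
  have hD : ((derivative A - derivative B : ℚ[X]) : PowerSeries ℚ)
      = ((A - B : ℚ[X]) : PowerSeries ℚ) * G + B * (G - H) := by
    rw [Polynomial.coe_sub, Polynomial.coe_sub, hA, hB]; ring
  have step : ∀ m ≤ n, (∀ i ≤ m, A.coeff i = B.coeff i) →
      (A.coeff (m + 1) - B.coeff (m + 1)) * (m + 1)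
        = PowerSeries.coeff m G - PowerSeries.coeff m H := by
    intro m hm hi
    have h := congrArg (PowerSeries.coeff m) hD
    rw [Polynomial.coeff_coe, map_add, PowerSeries.coeff_mul, PowerSeries.coeff_mul,
      coeff_sub, coeff_derivative, coeff_derivative, Finset.sum_eq_zero, zero_add,
      Finset.sum_eq_single (0, m)] at h
    · simp only [Polynomial.coeff_coe, hB0, one_mul, map_sub] at h
      linarith
    · rintro ⟨a, b⟩ hab hne
      replace hab : a + b = m := Finset.HasAntidiagonal.mem_antidiagonal.1 hab
      have : b < n := by
        have : a ≠ 0 := by rintro rfl; apply hne; simp_all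
        omega
      simp [hlt b this]
    · intro h; simp at h
    · rintro ⟨a, b⟩ hab
      replace hab : a + b = m := Finset.HasAntidiagonal.mem_antidiagonal.1 hab
      rw [Polynomial.coeff_coe, coeff_sub, hi a (by omega), sub_self, zero_mul]
  have hlow : ∀ m ≤ n, ∀ i ≤ m, A.coeff i = B.coeff i := by
    intro m
    induction m with
    | zero => intro _ i hi; obtain rfl : i = 0 := by omega
              rw [hA0, hB0]
    | succ m ih =>
      intro hm i hi
      rcases Nat.lt_or_ge i (m + 1) with h | h
      · exact ih (by omega) i (by omega)
      obtain rfl : i = m + 1 := by omega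
      have h1 := step m (by omega) (ih (by omega))
      rw [hlt m (by omega), sub_self] at h1
      rcases mul_eq_zero.1 h1 with h2 | h2
      · linarith
      · exact absurd h2 (by positivity)
  refine ⟨fun i hi => hlow n le_rfl i (by omega), fun h => hn ?_⟩
  have := step n le_rfl (hlow n le_rfl)
  rw [h, sub_self, zero_mul] at this
  linarith

theorem derivative_prod_one_add_smul_X (n : ℕ) (e : ℕ → ℕ) :
    ((derivative (∏ i ∈ Finset.range n, (1 + C (i : ℚ) * X) ^ e i) : ℚ[X]) : PowerSeries ℚ) =
      ((∏ i ∈ Finset.range n, (1 + C (i : ℚ) * X) ^ e i : ℚ[X]) : PowerSeries ℚ) *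
        PowerSeries.mk fun m => ∑ i ∈ Finset.range n, (e i : ℚ) * (i * (-i) ^ m) := by
  have hlin : ∀ a : ℚ, ((1 + C a * X : ℚ[X]) : PowerSeries ℚ) *
      PowerSeries.mk (fun m => a * (-a) ^ m) = PowerSeries.C a := by
    intro a
    have : ((1 + C a * X : ℚ[X]) : PowerSeries ℚ) = 1 + PowerSeries.C a * PowerSeries.X := by
      simp
    rw [this, add_mul, one_mul, mul_assoc]
    ext m
    cases m with
    | zero => simp
    | succ m =>
      rw [map_add, PowerSeries.coeff_C_mul, PowerSeries.coeff_succ_X_mul]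
      simp [pow_succ]
      ring
  have hpow : ∀ (a : ℚ) (k : ℕ), ((derivative ((1 + C a * X) ^ k) : ℚ[X]) : PowerSeries ℚ) =
      (((1 + C a * X) ^ k : ℚ[X]) : PowerSeries ℚ) *
        PowerSeries.mk fun m => (k : ℚ) * (a * (-a) ^ m) := by
    intro a k
    have hmk : (PowerSeries.mk fun m => (k : ℚ) * (a * (-a) ^ m))
        = PowerSeries.C (k : ℚ) * PowerSeries.mk (fun m => a * (-a) ^ m) := by
      ext m; rw [PowerSeries.coeff_C_mul, PowerSeries.coeff_mk, PowerSeries.coeff_mk]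
    cases k with
    | zero => rw [hmk]; simp
    | succ k =>
      rw [hmk, derivative_pow_succ]
      have h := hlin a
      simp only [derivative_add, derivative_one, zero_add, derivative_C_mul, derivative_X,
        mul_one, Polynomial.coe_mul, Polynomial.coe_C, Polynomial.coe_pow, pow_succ] at h ⊢
      rw [← h]
      push_cast
      ring
  induction n with
  | zero => ext m; simp
  | succ n ih =>
    rw [Finset.prod_range_succ, derivative_mul]
    have hmk : (PowerSeries.mk fun m => ∑ i ∈ Finset.range (n + 1), (e i : ℚ) * (i * (-i) ^ m))
        = (PowerSeries.mk fun m => ∑ i ∈ Finset.range n, (e i : ℚ) * (i * (-i) ^ m))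
          + PowerSeries.mk fun m => (e n : ℚ) * (n * (-n) ^ m) := by
      ext m; simp [Finset.sum_range_succ]
    rw [hmk, Polynomial.coe_add, Polynomial.coe_mul, Polynomial.coe_mul, Polynomial.coe_mul, ih,
      hpow]
    ring

theorem sum_neg_one_pow_mul_choose_mul_pow (N m : ℕ) :
    ∑ i ∈ Finset.range (N + 1), ((-1 : ℚ) ^ i * N.choose i) * (i : ℚ) ^ m =
      (-1) ^ N * (fwdDiff 1)^[N] (fun r : ℚ => r ^ m) 0 := by
  rw [fwdDiff_iter_eq_sum_shift, Finset.mul_sum]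
  refine Finset.sum_congr rfl fun i hi => ?_
  obtain ⟨d, rfl⟩ := Nat.exists_eq_add_of_le (Nat.lt_succ_iff.1 (Finset.mem_range.1 hi))
  have h1 : ((-1 : ℚ)) ^ d * (-1) ^ d = 1 := by rw [← mul_pow]; simp
  simp only [add_tsub_cancel_left, zsmul_eq_mul, nsmul_eq_mul, mul_one, zero_add]
  push_cast
  rw [pow_add]
  linear_combination (-((-1 : ℚ) ^ i * ((i + d).choose i) * (i : ℚ) ^ m)) * h1

theorem exists_prod_linear_congr (n : ℕ) (S : Submonoid ℚ[X])
    (hS : ∀ i : ℕ, 1 + C (i : ℚ) * X ∈ S) :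
    ∃ A ∈ S, ∃ B ∈ S, A.coeff 0 = 1 ∧ B.coeff 0 = 1 ∧
      (∀ i < n + 1, A.coeff i = B.coeff i) ∧ A.coeff (n + 1) ≠ B.coeff (n + 1) := by
  set P : (ℕ → ℕ) → ℚ[X] := fun e => ∏ i ∈ Finset.range (n + 1 + 1), (1 + C (i : ℚ) * X) ^ e i
  have hP : ∀ e, P e ∈ S := fun e => prod_mem fun i _ => pow_mem (hS i) _
  have hP0 : ∀ e, (P e).coeff 0 = 1 := fun e => by
    rw [coeff_zero_eq_eval_zero, eval_prod]; simp
  let a : ℕ → ℕ := fun i => if Even i then (n + 1).choose i else 0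
  let b : ℕ → ℕ := fun i => if Even i then 0 else (n + 1).choose i
  have hab : ∀ i, (a i : ℚ) - b i = (-1) ^ i * (n + 1).choose i := by
    intro i
    by_cases h : Even i
    · simp [a, b, h, h.neg_one_pow]
    · simp [a, b, h, (Nat.not_even_iff_odd.1 h).neg_one_pow]
  have hdiff : ∀ m, (∑ i ∈ Finset.range (n + 1 + 1), (a i : ℚ) * (i * (-i) ^ m)) -
      ∑ i ∈ Finset.range (n + 1 + 1), (b i : ℚ) * (i * (-i) ^ m) =
      (-1) ^ m * ∑ i ∈ Finset.range (n + 1 + 1),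
        ((-1 : ℚ) ^ i * (n + 1).choose i) * (i : ℚ) ^ (m + 1) := by
    intro m
    rw [← Finset.sum_sub_distrib, Finset.mul_sum]
    refine Finset.sum_congr rfl fun i _ => ?_
    rw [← hab, neg_pow (i : ℚ) m]
    ring
  obtain ⟨h1, h2⟩ := coeff_eq_of_logDeriv (n := n) (hP0 a) (hP0 b)
    (derivative_prod_one_add_smul_X _ a) (derivative_prod_one_add_smul_X _ b)
    (fun m hm => by
      rw [PowerSeries.coeff_mk, PowerSeries.coeff_mk, ← sub_eq_zero, hdiff,
        sum_neg_one_pow_mul_choose_mul_pow, fwdDiff_iter_pow_eq_zero_of_lt (by omega)]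
      simp)
    (by
      rw [PowerSeries.coeff_mk, PowerSeries.coeff_mk, ← sub_ne_zero, hdiff,
        sum_neg_one_pow_mul_choose_mul_pow, fwdDiff_iter_eq_factorial]
      simp [Nat.factorial_ne_zero])
  exact ⟨P a, hP a, P b, hP b, hP0 a, hP0 b, h1, h2⟩

/-- Multiplicative maps on the cone that preserve supports and constant terms. -/
structure IsSupportHom (Ψ : ℚ[X] → ℝ[X]) : Prop where
  nonneg : ∀ p ∈ UnitCone, ∀ k, 0 ≤ (Ψ p).coeff k
  coeff_zero : ∀ p ∈ UnitCone, (Ψ p).coeff 0 = 1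
  pos_iff : ∀ p ∈ UnitCone, ∀ k, 0 < (Ψ p).coeff k ↔ 0 < p.coeff k
  map_mul : ∀ p ∈ UnitCone, ∀ q ∈ UnitCone, Ψ (p * q) = Ψ p * Ψ q

/-- The substitution `X ↦ γ X`, viewed as a homomorphism from rational to real polynomials. -/
noncomputable def scaleHom (γ : ℝ) : ℚ[X] →ₐ[ℚ] ℝ[X] := aeval (C γ * X)

theorem scaleHom_apply (γ : ℝ) (p : ℚ[X]) :
    scaleHom γ p = (p.map (algebraMap ℚ ℝ)).comp (C γ * X) := by
  rw [scaleHom, aeval_def, comp, eval₂_map]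
  rfl

theorem coeff_scaleHom (γ : ℝ) (p : ℚ[X]) (k : ℕ) :
    (scaleHom γ p).coeff k = p.coeff k * γ ^ k := by
  rw [scaleHom_apply, comp_C_mul_X_coeff, coeff_map]
  rfl

theorem X_pow_dvd_scaleHom {γ : ℝ} {K : ℕ} {p : ℚ[X]} (h : X ^ K ∣ p) :
    X ^ K ∣ scaleHom γ p := by
  rw [X_pow_dvd_iff] at h ⊢
  intro d hd
  rw [coeff_scaleHom, h d hd]
  simp

theorem scaleHom_one_add_monomial (γ : ℝ) (c : ℚ) (j : ℕ) :
    scaleHom γ (1 + C c * X ^ j) = 1 + C (c * γ ^ j) * X ^ j := by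
  ext k
  rw [coeff_scaleHom]
  simp only [coeff_add, coeff_one, coeff_C_mul, coeff_X_pow]
  split_ifs <;> simp_all

/-- Cancellation of a polynomial with constant term `1` modulo a power of `X`. -/
theorem X_pow_dvd_of_dvd_mul {E y : ℝ[X]} {K : ℕ} (hE : E.coeff 0 = 1) (h : X ^ K ∣ E * y) :
    X ^ K ∣ y := by
  have hX : (X : ℝ[X]) ∣ E - 1 := by rw [X_dvd_iff]; simp [hE]
  obtain ⟨v, hv⟩ := hX
  have hc : IsCoprime (X : ℝ[X]) E := ⟨-v, 1, by linear_combination hv⟩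
  exact hc.pow_left.dvd_of_dvd_mul_left h

namespace IsSupportHom

variable {Ψ : ℚ[X] → ℝ[X]}

theorem dvd_sub_one (h : IsSupportHom Ψ) {p : ℚ[X]} (hp : p ∈ UnitCone) {K : ℕ}
    (hd : X ^ K ∣ p - 1) : X ^ K ∣ Ψ p - 1 := by
  rw [X_pow_dvd_iff] at hd ⊢
  intro i hi
  have h1 := hd i hi
  rw [coeff_sub, coeff_one] at h1 ⊢
  by_cases h0 : i = 0
  · subst h0; simp [h.coeff_zero p hp]
  · rw [if_neg h0] at h1 ⊢
    have h2 := (h.pos_iff p hp i).not.2 (by linarith)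
    linarith [h.nonneg p hp i]

theorem congr (h : IsSupportHom Ψ) {p q : ℚ[X]} (hp : p ∈ UnitCone) (hq : q ∈ UnitCone) {K : ℕ}
    (hK : 1 ≤ K) (hpq : X ^ K ∣ p - q) : X ^ K ∣ Ψ p - Ψ q := by
  obtain ⟨u, hpu, hqu, hpu1, hqu1⟩ := exists_common_multiplier hp hq hK hpq
  have h1 : Ψ (q * u) * Ψ p = Ψ q * Ψ (p * u) := by
    rw [← h.map_mul _ hqu _ hp, ← h.map_mul _ hq _ hpu]
    congr 1; ring
  have h2 : Ψ p - Ψ q = Ψ q * (Ψ (p * u) - 1) - Ψ p * (Ψ (q * u) - 1) := by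
    linear_combination h1
  rw [h2]
  exact dvd_sub ((h.dvd_sub_one hpu hpu1).mul_left _) ((h.dvd_sub_one hqu hqu1).mul_left _)

theorem map_one (h : IsSupportHom Ψ) : Ψ 1 = 1 := by
  ext i
  have := X_pow_dvd_iff.1 (h.dvd_sub_one (one_mem UnitCone) (K := i + 1) (by simp)) i (by omega)
  rw [coeff_sub] at this
  linarith

theorem map_one_add_monomial (h : IsSupportHom Ψ) {c : ℚ} (hc : 0 ≤ c) {j : ℕ} (hj : 1 ≤ j) :
    Ψ (1 + C c * X ^ j) = 1 + C ((Ψ (1 + C c * X ^ j)).coeff j) * X ^ j := by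
  have hm := one_add_monomial_mem_unitCone hc hj
  ext i
  simp only [coeff_add, coeff_one, coeff_C_mul, coeff_X_pow]
  rcases eq_or_ne i 0 with rfl | h0
  · simp [h.coeff_zero _ hm, show (0 : ℕ) ≠ j by omega]
  rcases eq_or_ne i j with rfl | hij
  · simp [h0]
  · have h2 := (h.pos_iff _ hm i).not.2 (by simp [coeff_one, coeff_X_pow, h0, hij])
    simp only [h0, hij, if_false]
    linarith [h.nonneg _ hm i]

theorem coeff_add_monomial (h : IsSupportHom Ψ) {c d : ℚ} (hc : 0 ≤ c) (hd : 0 ≤ d) {j : ℕ}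
    (hj : 1 ≤ j) : (Ψ (1 + C (c + d) * X ^ j)).coeff j =
      (Ψ (1 + C c * X ^ j)).coeff j + (Ψ (1 + C d * X ^ j)).coeff j := by
  have hmc := one_add_monomial_mem_unitCone hc hj
  have hmd := one_add_monomial_mem_unitCone hd hj
  have hmcd := one_add_monomial_mem_unitCone (add_nonneg hc hd) hj
  have h1 : (X : ℚ[X]) ^ (j + 1) ∣
      (1 + C c * X ^ j) * (1 + C d * X ^ j) - (1 + C (c + d) * X ^ j) := by
    have : (1 + C c * X ^ j) * (1 + C d * X ^ j) - (1 + C (c + d) * X ^ j)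
        = X ^ (j + j) * (C c * C d) := by rw [C_add]; ring
    rw [this]
    exact (pow_dvd_pow _ (by omega)).mul_right _
  have h2 := X_pow_dvd_iff.1 (h.congr (mul_mem hmc hmd) hmcd (by omega) h1) j (by omega)
  rw [h.map_mul _ hmc _ hmd, h.map_one_add_monomial hc hj, h.map_one_add_monomial hd hj] at h2
  set a := (Ψ (1 + C c * X ^ j)).coeff j
  set b := (Ψ (1 + C d * X ^ j)).coeff j
  have h3 : (1 + C a * X ^ j) * (1 + C b * X ^ j)
      = 1 + C (a + b) * X ^ j + C (a * b) * X ^ (j + j) := by rw [C_add, C_mul]; ring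
  rw [h3, coeff_sub] at h2
  rw [coeff_add, coeff_add, coeff_C_mul_X_pow, coeff_C_mul_X_pow, if_pos rfl,
    if_neg (by omega), coeff_one, if_neg (by omega)] at h2
  linarith

theorem coeff_monomial_eq_mul (h : IsSupportHom Ψ) {c : ℚ} (hc : 0 ≤ c) {j : ℕ} (hj : 1 ≤ j) :
    (Ψ (1 + C c * X ^ j)).coeff j = c * (Ψ (1 + C 1 * X ^ j)).coeff j := by
  have hn : ∀ (n : ℕ) (c : ℚ), 0 ≤ c →
      (Ψ (1 + C (n * c) * X ^ j)).coeff j = n * (Ψ (1 + C c * X ^ j)).coeff j := by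
    intro n c hc
    induction n with
    | zero => simp [h.map_one, coeff_one, show j ≠ 0 by omega]
    | succ n ih =>
      push_cast
      rw [add_mul, one_mul, h.coeff_add_monomial (by positivity) hc hj, ih]
      ring
  have h1 := hn c.den c hc
  have h2 := hn c.num.natAbs 1 zero_le_one
  have h3 : (c.num.natAbs : ℚ) = c.den * c := by
    rw [mul_comm, Rat.mul_den_eq_num, Nat.cast_natAbs, abs_of_nonneg (Rat.num_nonneg.2 hc)]
  have h4 : (c.num.natAbs : ℝ) = c.den * c := by exact_mod_cast congrArg (Rat.cast : ℚ → ℝ) h3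
  rw [mul_one, h3, h4, h1] at h2
  have h5 : (c.den : ℝ) ≠ 0 := by exact_mod_cast c.den_ne_zero
  apply mul_left_cancel₀ h5
  rw [h2]; ring

theorem coeff_monomial_eq_pow (h : IsSupportHom Ψ) {j : ℕ} (hj : 1 ≤ j) :
    (Ψ (1 + C 1 * X ^ j)).coeff j = (Ψ (1 + C 1 * X ^ 1)).coeff 1 ^ j := by
  set γ := (Ψ (1 + C 1 * X ^ 1)).coeff 1 with hγ
  set g := (Ψ (1 + C 1 * X ^ j)).coeff j with hg
  let S : Submonoid ℚ[X] :=
    { carrier := {p | p ∈ UnitCone ∧ Ψ p = scaleHom γ p}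
      one_mem' := ⟨one_mem _, by rw [h.map_one, _root_.map_one]⟩
      mul_mem' := by
        rintro p q ⟨hp, hp'⟩ ⟨hq, hq'⟩
        exact ⟨mul_mem hp hq, by rw [h.map_mul p hp q hq, _root_.map_mul, hp', hq']⟩ }
  have hS : ∀ i : ℕ, 1 + C (i : ℚ) * X ∈ S := by
    intro i
    have hi : (0 : ℚ) ≤ i := Nat.cast_nonneg i
    refine ⟨by simpa using one_add_monomial_mem_unitCone hi le_rfl, ?_⟩
    have h1 := h.map_one_add_monomial hi le_rfl
    rw [h.coeff_monomial_eq_mul hi le_rfl, ← hγ] at h1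
    have h2 := scaleHom_one_add_monomial γ i 1
    simp only [pow_one] at h1 h2
    rw [h1, h2]
  obtain ⟨n, rfl⟩ : ∃ n, j = n + 1 := ⟨j - 1, by omega⟩
  have main : ∀ A ∈ S, ∀ B ∈ S, B.coeff 0 = 1 → (∀ i < n + 1, A.coeff i = B.coeff i) →
      B.coeff (n + 1) < A.coeff (n + 1) → g = γ ^ (n + 1) := by
    rintro A ⟨hA, hA'⟩ B ⟨hB, hB'⟩ hB0 hlow hlt
    set c := A.coeff (n + 1) - B.coeff (n + 1) with hcdef
    have hc : 0 < c := sub_pos.2 hlt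
    have hE := one_add_monomial_mem_unitCone hc.le hj
    have hd : X ^ (n + 1 + 1) ∣ A - B * (1 + C c * X ^ (n + 1)) := by
      rw [X_pow_dvd_iff]
      intro i hi
      have : B * (1 + C c * X ^ (n + 1)) = B + C c * B * X ^ (n + 1) := by ring
      rw [this, coeff_sub, coeff_add, coeff_mul_X_pow', coeff_C_mul]
      split_ifs with h1
      · obtain rfl : i = n + 1 := by omega
        simp [hB0, hcdef]
      · rw [hlow i (by omega)]; ring
    have h1 := h.congr hA (mul_mem hB hE) (by omega) hd
    rw [h.map_mul _ hB _ hE, h.map_one_add_monomial hc.le hj, h.coeff_monomial_eq_mul hc.le hj,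
      hA', hB', ← hg] at h1
    have h2 := X_pow_dvd_scaleHom (γ := γ) hd
    rw [map_sub, _root_.map_mul, scaleHom_one_add_monomial] at h2
    have h3 := dvd_sub h2 h1
    have h4 : scaleHom γ A - scaleHom γ B * (1 + C (c * γ ^ (n + 1)) * X ^ (n + 1)) -
        (scaleHom γ A - scaleHom γ B * (1 + C (c * g) * X ^ (n + 1))) =
        C (c * g - c * γ ^ (n + 1)) * scaleHom γ B * X ^ (n + 1) := by
      rw [C_sub]; ring
    rw [h4] at h3
    have h5 := X_pow_dvd_iff.1 h3 (n + 1) (by omega)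
    rw [coeff_mul_X_pow', if_pos le_rfl, Nat.sub_self, coeff_C_mul, coeff_scaleHom, hB0] at h5
    have hc' : (c : ℝ) ≠ 0 := by exact_mod_cast hc.ne'
    apply mul_left_cancel₀ hc'
    simp at h5
    linarith
  obtain ⟨A, hA, B, hB, hA0, hB0, hlow, hne⟩ := exists_prod_linear_congr n S hS
  rcases hne.lt_or_gt with hlt | hlt
  · exact main B hB A hA hA0 (fun i hi => (hlow i hi).symm) hlt
  · exact main A hA B hB hB0 hlow hlt

theorem cross_congr (h : IsSupportHom Ψ) {γ : ℝ} (hγ : γ = (Ψ (1 + C 1 * X ^ 1)).coeff 1)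
    (d : ℕ) : ∀ j ≥ 1, ∀ p ∈ UnitCone, ∀ q ∈ UnitCone, X ^ j ∣ p - q →
      X ^ (j + d) ∣ Ψ p * scaleHom γ q - Ψ q * scaleHom γ p := by
  induction d with
  | zero =>
    intro j hj p hp q hq hpq
    have h1 := h.congr hp hq hj hpq
    have h2 := X_pow_dvd_scaleHom (γ := γ) hpq
    rw [map_sub] at h2
    have : Ψ p * scaleHom γ q - Ψ q * scaleHom γ p =
        (Ψ p - Ψ q) * scaleHom γ q - Ψ q * (scaleHom γ p - scaleHom γ q) := by ring
    rw [this]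
    exact dvd_sub (h1.mul_right _) (h2.mul_left _)
  | succ d ih =>
    intro j hj
    have main : ∀ p ∈ UnitCone, ∀ q ∈ UnitCone, X ^ j ∣ p - q → q.coeff j ≤ p.coeff j →
        X ^ (j + (d + 1)) ∣ Ψ p * scaleHom γ q - Ψ q * scaleHom γ p := by
      intro p hp q hq hpq hle
      set c := p.coeff j - q.coeff j with hcdef
      have hc : 0 ≤ c := sub_nonneg.2 hle
      have hE := one_add_monomial_mem_unitCone hc hj
      have hd : X ^ (j + 1) ∣ p - q * (1 + C c * X ^ j) := by
        rw [X_pow_dvd_iff]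
        intro i hi
        have : p - q * (1 + C c * X ^ j) = (p - q) - C c * q * X ^ j := by ring
        rw [this, coeff_sub, coeff_mul_X_pow', coeff_C_mul]
        split_ifs with h1
        · obtain rfl : i = j := by omega
          simp [hq.2, hcdef]
        · rw [X_pow_dvd_iff.1 hpq i (by omega)]; ring
      have h1 := ih (j + 1) (by omega) p hp _ (mul_mem hq hE) hd
      have h2 : Ψ (1 + C c * X ^ j) = 1 + C (c * γ ^ j) * X ^ j := by
        rw [h.map_one_add_monomial hc hj, h.coeff_monomial_eq_mul hc hj,
          h.coeff_monomial_eq_pow hj, ← hγ]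
      rw [h.map_mul _ hq _ hE, _root_.map_mul, scaleHom_one_add_monomial, h2] at h1
      have h3 : Ψ p * (scaleHom γ q * (1 + C (c * γ ^ j) * X ^ j)) -
          Ψ q * (1 + C (c * γ ^ j) * X ^ j) * scaleHom γ p =
          (1 + C (c * γ ^ j) * X ^ j) * (Ψ p * scaleHom γ q - Ψ q * scaleHom γ p) := by ring
      rw [h3, show j + 1 + d = j + (d + 1) by ring] at h1
      exact X_pow_dvd_of_dvd_mul (by simp [coeff_X_pow, show 0 ≠ j by omega]) h1
    intro p hp q hq hpq
    rcases le_total (q.coeff j) (p.coeff j) with hle | hle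
    · exact main p hp q hq hpq hle
    · rw [← dvd_neg, neg_sub]
      rw [← dvd_neg, neg_sub] at hpq
      exact main q hq p hp hpq hle

theorem exists_eq_scaleHom (h : IsSupportHom Ψ) :
    ∃ γ : ℝ, 0 < γ ∧ ∀ p ∈ UnitCone, Ψ p = scaleHom γ p := by
  refine ⟨(Ψ (1 + C 1 * X ^ 1)).coeff 1, ?_, fun p hp => ?_⟩
  · rw [h.pos_iff _ (one_add_monomial_mem_unitCone zero_le_one le_rfl)]
    simp [coeff_one]
  · ext i
    have h1 := h.cross_congr rfl i 1 le_rfl p hp 1 (one_mem _)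
      (by rw [pow_one, X_dvd_iff]; simp [hp.2])
    rw [h.map_one, _root_.map_one, mul_one, one_mul] at h1
    have := X_pow_dvd_iff.1 h1 i (by omega)
    rw [coeff_sub] at this
    linarith

end IsSupportHom

/-- The real polynomial proportional to `p` whose coefficients sum to `1`. -/
noncomputable def sumNormalize (p : ℚ[X]) : ℝ[X] :=
  C ((p.eval 1 : ℚ) : ℝ)⁻¹ * p.map (algebraMap ℚ ℝ)

theorem coeff_sumNormalize (p : ℚ[X]) (k : ℕ) :
    (sumNormalize p).coeff k = (((p.eval 1)⁻¹ * p.coeff k : ℚ) : ℝ) := by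
  simp [sumNormalize, coeff_C_mul, coeff_map]

theorem sumNormalize_mul (p q : ℚ[X]) : sumNormalize (p * q) = sumNormalize p * sumNormalize q := by
  simp only [sumNormalize, eval_mul, Rat.cast_mul, mul_inv, C_mul, Polynomial.map_mul]
  ring

theorem eval_one_pos {p : ℚ[X]} (hp : p ∈ UnitCone) : 0 < p.eval 1 := by
  rw [eval_eq_sum_range]
  refine Finset.sum_pos' (fun i _ => by simpa using hp.1 i) ⟨0, by simp, by simp [hp.2]⟩

theorem sumNormalize_mem {p : ℚ[X]} (hp : p ∈ UnitCone) : sumNormalize p ∈ PQset := by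
  have h1 := eval_one_pos hp
  refine ⟨⟨fun k => ?_, ?_⟩, fun k => ⟨_, coeff_sumNormalize p k⟩⟩
  · rw [coeff_sumNormalize]
    exact_mod_cast mul_nonneg (inv_nonneg.2 h1.le) (hp.1 k)
  · have h2 : (p.map (algebraMap ℚ ℝ)).eval 1 = ((p.eval 1 : ℚ) : ℝ) := by
      simpa using eval_map_apply (f := algebraMap ℚ ℝ) (p := p) 1
    rw [sumNormalize, eval_mul, eval_C, h2]
    exact inv_mul_cancel₀ (by exact_mod_cast h1.ne')

theorem coeff_sumNormalize_pos_iff {p : ℚ[X]} (hp : p ∈ UnitCone) (k : ℕ) :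
    0 < (sumNormalize p).coeff k ↔ 0 < p.coeff k := by
  rw [coeff_sumNormalize, Rat.cast_pos]
  exact mul_pos_iff_of_pos_left (inv_pos.2 (eval_one_pos hp))

/-- Every element of `PQset` is a monomial times the normalization of a polynomial with
constant term `1`. -/
theorem exists_eq_X_pow_mul_sumNormalize {p : ℝ[X]} (hp : p ∈ PQset) :
    ∃ (m : ℕ) (q : ℚ[X]), q ∈ UnitCone ∧ p = X ^ m * sumNormalize q := by
  obtain ⟨r, rfl⟩ : ∃ r : ℚ[X], r.map (algebraMap ℚ ℝ) = p := by
    have : p ∈ lifts (algebraMap ℚ ℝ) := by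
      rw [lifts_iff_coeff_lifts]
      intro k
      obtain ⟨a, ha⟩ := hp.2 k
      exact ⟨a, by rw [ha]; rfl⟩
    exact (mem_lifts p).1 this
  obtain ⟨⟨hnn, h1⟩, -⟩ := hp
  have hr : r ≠ 0 := by rintro rfl; simp at h1
  obtain ⟨s, hs⟩ : X ^ r.natTrailingDegree ∣ r :=
    X_pow_dvd_iff.2 fun d hd => coeff_eq_zero_of_lt_natTrailingDegree hd
  set m := r.natTrailingDegree with hm
  have hcoeff : ∀ k, s.coeff k = r.coeff (k + m) := fun k => by
    rw [hs, mul_comm, coeff_mul_X_pow]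
  have hsnn : ∀ k, 0 ≤ s.coeff k := fun k => by
    have := hnn (k + m)
    rw [coeff_map, eq_ratCast, Rat.cast_nonneg] at this
    rwa [hcoeff]
  have hs0 : s.coeff 0 ≠ 0 := by
    rw [hcoeff, zero_add, hm]
    exact mt trailingCoeff_eq_zero.1 hr
  have hs1 : s.eval 1 = 1 := by
    have h2 : (r.map (algebraMap ℚ ℝ)).eval 1 = ((r.eval 1 : ℚ) : ℝ) := by
      simpa using eval_map_apply (f := algebraMap ℚ ℝ) (p := r) 1
    rw [h2, hs] at h1
    have h3 : (X ^ m * s).eval 1 = 1 := Rat.cast_injective (α := ℝ) (by rw [h1, Rat.cast_one])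
    simpa using h3
  refine ⟨m, C (s.coeff 0)⁻¹ * s, ⟨fun k => ?_, ?_⟩, ?_⟩
  · rw [coeff_C_mul]
    exact mul_nonneg (inv_nonneg.2 (hsnn 0)) (hsnn k)
  · rw [coeff_C_mul, inv_mul_cancel₀ hs0]
  · have h3 : sumNormalize (C (s.coeff 0)⁻¹ * s) = s.map (algebraMap ℚ ℝ) := by
      ext k
      rw [coeff_sumNormalize, coeff_map, eval_mul, eval_C, hs1, coeff_C_mul]
      congr 1
      field_simp
    rw [h3, hs, Polynomial.map_mul]
    simp

theorem X_pow_mem_PQset (m : ℕ) : (X ^ m : ℝ[X]) ∈ PQset := by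
  refine ⟨⟨fun k => ?_, by simp⟩, fun k => ⟨if k = m then 1 else 0, ?_⟩⟩
  · rw [coeff_X_pow]; positivity
  · rw [coeff_X_pow]; split_ifs <;> simp

theorem stmt_1 (Φ : Polynomial ℝ → Polynomial ℝ)
    (hmap : ∀ p ∈ PQset, Φ p ∈ Pset)
    (hsupp : ∀ p ∈ PQset, ∀ k : ℕ, 0 < (Φ p).coeff k ↔ 0 < p.coeff k)
    (hmul : ∀ p ∈ PQset, ∀ q ∈ PQset, Φ (p * q) = Φ p * Φ q) :
    ∃ γ : ℝ, 0 < γ ∧ ∀ p ∈ PQset,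
      Φ p = C (p.eval γ)⁻¹ * p.comp (C γ * X) := by
  have hpos : ∀ p ∈ UnitCone, 0 < (Φ (sumNormalize p)).coeff 0 := fun p hp => by
    rw [hsupp _ (sumNormalize_mem hp), coeff_sumNormalize_pos_iff hp, hp.2]
    exact one_pos
  have hΨ : IsSupportHom fun p =>
      C ((Φ (sumNormalize p)).coeff 0)⁻¹ * Φ (sumNormalize p) := by
    refine ⟨fun p hp k => ?_, fun p hp => ?_, fun p hp k => ?_, fun p hp q hq => ?_⟩
    · rw [coeff_C_mul]
      exact mul_nonneg (inv_nonneg.2 (hpos p hp).le) ((hmap _ (sumNormalize_mem hp)).1 k)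
    · rw [coeff_C_mul]
      exact inv_mul_cancel₀ (hpos p hp).ne'
    · rw [coeff_C_mul, mul_pos_iff_of_pos_left (inv_pos.2 (hpos p hp)),
        hsupp _ (sumNormalize_mem hp), coeff_sumNormalize_pos_iff hp]
    · simp only [sumNormalize_mul, hmul _ (sumNormalize_mem hp) _ (sumNormalize_mem hq), mul_coeff_zero,
        mul_inv, C_mul]
      ring
  have hX : ∀ m : ℕ, Φ (X ^ m) = X ^ m := by
    intro m
    obtain ⟨hnn, h1⟩ := hmap _ (X_pow_mem_PQset m)
    have h2 : Φ (X ^ m) = C ((Φ (X ^ m)).coeff m) * X ^ m := by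
      ext k
      rw [coeff_C_mul_X_pow]
      split_ifs with hk
      · rw [hk]
      · have := (hsupp _ (X_pow_mem_PQset m) k).not.2 (by simp [coeff_X_pow, hk])
        linarith [hnn k]
    rw [h2] at h1
    simp only [eval_mul, eval_C, eval_pow, eval_X, one_pow, mul_one] at h1
    rw [h2, h1]
    simp
  obtain ⟨γ, hγ, hscale⟩ := hΨ.exists_eq_scaleHom
  refine ⟨γ, hγ, fun p hp => ?_⟩
  obtain ⟨κ, hκ⟩ : ∃ κ : ℝ, Φ p = C κ * p.comp (C γ * X) := by
    obtain ⟨m, q, hq, rfl⟩ := exists_eq_X_pow_mul_sumNormalize hp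
    set b := (Φ (sumNormalize q)).coeff 0 with hb
    have hb0 : b ≠ 0 := (hpos q hq).ne'
    set a : ℝ := ((q.eval 1 : ℚ) : ℝ) with ha
    have ha0 : a ≠ 0 := Rat.cast_ne_zero.2 (eval_one_pos hq).ne'
    have h1 : Φ (sumNormalize q) = C b * scaleHom γ q := by
      rw [← hscale q hq, ← mul_assoc, ← C_mul, mul_inv_cancel₀ hb0, C_1, one_mul]
    refine ⟨b * a * (γ ^ m)⁻¹, ?_⟩
    rw [hmul _ (X_pow_mem_PQset m) _ (sumNormalize_mem hq), hX, h1, sumNormalize, scaleHom_apply,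
      mul_comp, mul_comp, X_pow_comp, C_comp, mul_pow, ← C_pow]
    have h2 : b = b * a * (γ ^ m)⁻¹ * γ ^ m * a⁻¹ := by field_simp
    conv_lhs => rw [h2]
    simp only [C_mul]
    ring
  have h1 := (hmap p hp).2
  rw [hκ] at h1
  simp only [eval_mul, eval_C, eval_comp, eval_X, mul_one] at h1
  rw [hκ, eq_inv_of_mul_eq_one_left h1]
end

section
/- Let Φ : 𝒫(ℚ) → 𝒫(ℚ) be a support-preserving endomorphism. Then there exists a real constant β such that for every μ ∈ 𝒫(ℚ) and every q ∈ ℚ, Φ[μ](q) = μ(q)·exp(−βq) / (Σ_{y ∈ ℚ} μ(y)·exp(−βy)). -/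
/-- `PQmeas` is the set of finitely supported probability measures on `ℚ`,
represented as functions `ℚ → ℝ`. -/
def PQmeas : Set (ℚ → ℝ) :=
  {μ | (Function.support μ).Finite ∧ (∀ q, 0 ≤ μ q) ∧ ∑ᶠ q, μ q = 1}

/-- Convolution of two functions `ℚ → ℝ`. -/
noncomputable def convQ (μ ν : ℚ → ℝ) : ℚ → ℝ := fun q => ∑ᶠ t, μ t * ν (q - t)

open Polynomial

/-- The functional equation satisfied by the action of a support-preserving endomorphism on linear
polynomials forces linearity on the positive half-line. -/
theorem linear_of_functional_equation (φ : ℝ → ℝ) (hpos : ∀ a, 0 < a → 0 < φ a)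
    (hmono : ∀ a b, 0 < a → a < b → φ a < φ b)
    (heq : ∀ u b v, 0 < u → u < b → b < v →
      φ (u + v - u * v / b) * φ b = (φ u + φ v) * φ b - φ u * φ v) :
    ∃ k, 0 < k ∧ ∀ a, 0 < a → φ a = k * a := by
  have hle : ∀ a b, 0 < a → a ≤ b → φ a ≤ φ b := fun a b ha h =>
    h.eq_or_lt.elim (fun h => h ▸ le_rfl) fun h => (hmono a b ha h).le
  -- in the coordinate `t ↦ φ (c (1 + t)) - φ c` the equation becomes multiplicative
  have key : ∀ c s t, 0 < c → 0 < s → s < 1 → 0 < t →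
      (φ (c * (1 + s * t)) - φ c) * φ c = (φ c - φ (c * (1 - s))) * (φ (c * (1 + t)) - φ c) := by
    intro c s t hc hs hs1 ht
    have h := heq (c * (1 - s)) c (c * (1 + t)) (mul_pos hc (by linarith)) (by nlinarith)
      (by nlinarith)
    have e : c * (1 - s) + c * (1 + t) - c * (1 - s) * (c * (1 + t)) / c = c * (1 + s * t) := by
      field_simp; ring
    rw [e] at h
    linear_combination h
  have hinc : ∀ c t, 0 < c → 0 < t → 0 < φ (c * (1 + t)) - φ c := fun c t hc ht =>
    sub_pos.2 (hmono _ _ hc (by nlinarith))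
  have mul_lt : ∀ c x y, 0 < x → x < c → 0 < y → y < c →
      φ (x + y - x * y / c) * φ c = (φ x + φ y) * φ c - φ x * φ y := by
    intro c x y hx hxc hy hyc
    have hc : 0 < c := hx.trans hxc
    obtain ⟨s, rfl⟩ : ∃ s, x = c * (1 - s) := ⟨1 - x / c, by field_simp; ring⟩
    obtain ⟨s', rfl⟩ : ∃ s, y = c * (1 - s) := ⟨1 - y / c, by field_simp; ring⟩
    have hs : 0 < s := by nlinarith
    have hs' : 0 < s' := by nlinarith
    have h1s : 0 < 1 - s := pos_of_mul_pos_right hx hc.le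
    have h1s' : 0 < 1 - s' := pos_of_mul_pos_right hy hc.le
    have e : c * (1 - s) + c * (1 - s') - c * (1 - s) * (c * (1 - s')) / c
        = c * (1 - s * s') := by
      field_simp; ring
    rw [e]
    have k1 := key c s' 1 hc hs' (by linarith) one_pos
    have k2 := key c s (s' * 1) hc hs (by linarith) (by linarith)
    have k3 := key c (s * s') 1 hc (mul_pos hs hs') (by nlinarith) one_pos
    rw [mul_assoc] at k3
    have hne := (hinc c 1 hc one_pos).ne'
    apply mul_right_cancel₀ hne
    linear_combination φ c * k3 - φ c * k2 - (φ c - φ (c * (1 - s))) * k1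
  have unbdd : ∀ M, ∃ c₀, 0 < c₀ ∧ M < φ c₀ := by
    intro M
    have hr1 : 0 < φ 1 - φ (1 * (1 - 1 / 2)) := sub_pos.2 (hmono _ _ (by norm_num) (by norm_num))
    have hr2 : φ 1 - φ (1 * (1 - 1 / 2)) < φ 1 := by
      have := hpos (1 * (1 - 1 / 2)) (by norm_num)
      linarith
    set r := φ 1 / (φ 1 - φ (1 * (1 - 1 / 2))) with hr
    have hr1' : 1 < r := by rw [hr, one_lt_div hr1]; exact hr2
    have hrmul : r * (φ 1 - φ (1 * (1 - 1 / 2))) = φ 1 := div_mul_cancel₀ _ hr1.ne'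
    have hpow : ∀ n : ℕ, φ (1 * (1 + 2 ^ n)) - φ 1 = r ^ n * (φ (1 * (1 + 1)) - φ 1) := by
      intro n
      induction n with
      | zero => simp
      | succ n ih =>
        have h := key 1 (1 / 2) (2 ^ (n + 1)) one_pos (by norm_num) (by norm_num) (by positivity)
        rw [show (1 / 2 : ℝ) * 2 ^ (n + 1) = 2 ^ n by ring, ih] at h
        apply mul_left_cancel₀ hr1.ne'
        rw [pow_succ r]
        linear_combination -h - r ^ n * (φ (1 * (1 + 1)) - φ 1) * hrmul
    have hD := hinc 1 1 one_pos one_pos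
    obtain ⟨n, hn⟩ := pow_unbounded_of_one_lt (M / (φ (1 * (1 + 1)) - φ 1)) hr1'
    rw [div_lt_iff₀ hD, ← hpow] at hn
    exact ⟨1 * (1 + 2 ^ n), by positivity, by linarith [hpos 1 one_pos]⟩
  have superadd : ∀ x y, 0 < x → 0 < y → φ x + φ y ≤ φ (x + y) := by
    intro x y hx hy
    refine le_of_forall_pos_le_add fun ε hε => ?_
    obtain ⟨c₀, hc₀, hM⟩ := unbdd (φ x * φ y / ε)
    set c := max c₀ (x + y)
    have hxc : x < c := lt_of_lt_of_le (by linarith) (le_max_right _ _)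
    have hyc : y < c := lt_of_lt_of_le (by linarith) (le_max_right _ _)
    have hc : 0 < c := hx.trans hxc
    have hφc : φ x * φ y < φ c * ε := by
      rw [div_lt_iff₀ hε] at hM
      exact hM.trans_le (mul_le_mul_of_nonneg_right (hle _ _ hc₀ (le_max_left _ _)) hε.le)
    have h := mul_lt c x y hx hxc hy hyc
    have hxyc : 0 < x * y / c := by positivity
    have hyx : x * y / c < y := by rw [div_lt_iff₀ hc]; nlinarith
    have h1 := hle (x + y - x * y / c) (x + y) (by linarith) (by linarith)
    have hP := hpos c hc
    by_contra! hlt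
    nlinarith
  have subadd : ∀ x x' y, 0 < x → x < x' → 0 < y → φ (x + y) ≤ φ x' + φ y := by
    intro x x' y hx hxx hy
    set c := max (x' + y) (x' * y / (x' - x))
    have hx' : 0 < x' := hx.trans hxx
    have hxc : x' < c := lt_of_lt_of_le (by linarith) (le_max_left _ _)
    have hyc : y < c := lt_of_lt_of_le (by linarith) (le_max_left _ _)
    have hc : 0 < c := hy.trans hyc
    have hle' : x' * y / c ≤ x' - x := by
      rw [div_le_iff₀ hc, mul_comm (x' - x), ← div_le_iff₀ (by linarith)]
      exact le_max_right _ _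
    have h := mul_lt c x' y hx' hxc hy hyc
    have h1 := hle (x + y) (x' + y - x' * y / c) (by linarith) (by linarith)
    have hP := hpos c hc
    have := mul_pos (hpos x' hx') (hpos y hy)
    by_contra! hlt
    nlinarith
  have hmul1 : ∀ (n : ℕ) x, 0 < x → (n + 1 : ℝ) * φ x ≤ φ ((n + 1 : ℝ) * x) := by
    intro n x hx
    induction n with
    | zero => simp
    | succ n ih =>
      have := superadd ((n + 1 : ℝ) * x) x (by positivity) hx
      push_cast
      rw [show (n + 1 + 1 : ℝ) * x = (n + 1) * x + x by ring]
      linarith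
  have hmul2 : ∀ (n : ℕ) x x', 0 < x → x < x' → φ ((n + 1 : ℝ) * x) ≤ (n + 1 : ℝ) * φ x' := by
    intro n x x' hx hxx
    induction n with
    | zero => simpa using (hmono x x' hx hxx).le
    | succ n ih =>
      have := subadd x x' ((n + 1 : ℝ) * x) hx hxx (by positivity)
      push_cast
      rw [show (n + 1 + 1 : ℝ) * x = x + (n + 1) * x by ring]
      linarith
  have ratio : ∀ x z, 0 < x → 0 < z → φ x * z ≤ φ z * x := by
    intro x z hx hz
    by_contra! hlt
    have hφx := hpos x hx
    have hφz := hpos z hz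
    -- a rational number `p / q` strictly between `x / z` and `φ x / φ z`
    obtain ⟨r, hr1, hr2⟩ := exists_rat_btwn
      (show x / z < φ x / φ z by rw [div_lt_div_iff₀ hz hφz]; linarith)
    have hr : (0 : ℝ) < r := (div_pos hx hz).trans hr1
    have hr' : 0 < r := by exact_mod_cast hr
    obtain ⟨p, hp⟩ : ∃ p : ℕ, r.num = p + 1 := ⟨(r.num - 1).toNat, by
      have := Rat.num_pos.2 hr'; omega⟩
    obtain ⟨q, hq⟩ : ∃ q : ℕ, r.den = q + 1 := ⟨r.den - 1, by have := r.pos; omega⟩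
    have hrpq : (r : ℝ) = (p + 1) / (q + 1) := by
      rw [Rat.cast_def, hp, hq]; push_cast; rfl
    rw [hrpq] at hr1 hr2
    have hp0 : (0 : ℝ) < p + 1 := by positivity
    have hq0 : (0 : ℝ) < q + 1 := by positivity
    rw [div_lt_div_iff₀ hz hq0] at hr1
    rw [div_lt_div_iff₀ hq0 hφz] at hr2
    have hy : (q + 1) * x / (p + 1) < z := by
      rw [div_lt_iff₀ hp0]; linarith
    have h1 := hmul1 q x hx
    have h2 := hmul2 p ((q + 1) * x / (p + 1)) z (by positivity) hy
    rw [mul_div_cancel₀ _ hp0.ne'] at h2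
    linarith
  refine ⟨φ 1, hpos 1 one_pos, fun a ha => ?_⟩
  have h1 := ratio a 1 ha one_pos
  have h2 := ratio 1 a one_pos ha
  linarith

/-- Polynomials with constant coefficient `1` and nonnegative coefficients. -/
def NormalizedNonneg (f : ℝ[X]) : Prop := f.coeff 0 = 1 ∧ ∀ i, 0 ≤ f.coeff i

theorem NormalizedNonneg.mul {f g : ℝ[X]} (hf : NormalizedNonneg f) (hg : NormalizedNonneg g) :
    NormalizedNonneg (f * g) :=
  ⟨by rw [mul_coeff_zero, hf.1, hg.1, mul_one], fun i => by
    rw [coeff_mul]; exact Finset.sum_nonneg fun x _ => mul_nonneg (hf.2 _) (hg.2 _)⟩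

theorem NormalizedNonneg.ne_zero {f : ℝ[X]} (hf : NormalizedNonneg f) : f ≠ 0 := by
  rintro rfl; simpa using hf.1

theorem NormalizedNonneg.expand {f : ℝ[X]} (hf : NormalizedNonneg f) {m : ℕ} (hm : 0 < m) :
    NormalizedNonneg (expand ℝ m f) := by
  refine ⟨by simp [coeff_expand hm, hf.1], fun i => ?_⟩
  rw [coeff_expand hm]
  split_ifs
  exacts [hf.2 _, le_rfl]

/-- Multiplicative support-preserving self-maps of the monoid of normalized nonnegative
polynomials. -/
structure IsSupportEndo (Θ : ℝ[X] → ℝ[X]) : Prop where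
  normalized : ∀ f, NormalizedNonneg f → NormalizedNonneg (Θ f)
  coeff_eq_zero : ∀ f, NormalizedNonneg f → ∀ i, (Θ f).coeff i = 0 ↔ f.coeff i = 0
  map_mul : ∀ f g, NormalizedNonneg f → NormalizedNonneg g → Θ (f * g) = Θ f * Θ g

/-- The polynomial `1 + a X + b X² + c X³ + e X⁴`. -/
noncomputable def quartic (a b c e : ℝ) : ℝ[X] :=
  1 + C a * X + C b * X ^ 2 + C c * X ^ 3 + C e * X ^ 4

theorem coeff_quartic (a b c e : ℝ) (n : ℕ) : (quartic a b c e).coeff n =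
    if n = 0 then 1 else if n = 1 then a else if n = 2 then b else if n = 3 then c else
      if n = 4 then e else 0 := by
  simp only [quartic, coeff_add, coeff_one, coeff_C_mul, coeff_X, coeff_X_pow]
  rcases n with _ | _ | _ | _ | _ | n <;> simp

theorem normalizedNonneg_quartic {a b c e : ℝ} (ha : 0 ≤ a) (hb : 0 ≤ b) (hc : 0 ≤ c)
    (he : 0 ≤ e) : NormalizedNonneg (quartic a b c e) := by
  refine ⟨by simp [coeff_quartic], fun i => ?_⟩
  rw [coeff_quartic]
  split_ifs <;> first | assumption | norm_num

theorem quartic_mul_eq_quartic_mul {a b c e a' b' c' e' p q r s p' q' r' s' : ℝ}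
    (h : quartic a b c e * quartic a' b' c' e' = quartic p q r s * quartic p' q' r' s') :
    a + a' = p + p' ∧ b + a * a' + b' = q + p * p' + q' ∧
    c + b * a' + a * b' + c' = r + q * p' + p * q' + r' ∧
    e + c * a' + b * b' + a * c' + e' = s + r * p' + q * q' + p * r' + s' ∧
    e * a' + c * b' + b * c' + a * e' = s * p' + r * q' + q * r' + p * s' := by
  have key : ∀ n, _ := fun n => congrArg (fun f => coeff f n) h
  have h1 := key 1
  have h2 := key 2
  have h3 := key 3
  have h4 := key 4
  have h5 := key 5
  simp [coeff_mul, Finset.Nat.antidiagonal_succ, coeff_quartic] at h1 h2 h3 h4 h5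
  refine ⟨?_, ?_, ?_, ?_, ?_⟩ <;> linarith

theorem quartic_mul_quartic (a b : ℝ) :
    quartic a 0 0 0 * quartic b 0 0 0 = quartic (a + b) (a * b) 0 0 := by
  simp only [quartic, map_add, map_mul, map_zero]
  ring

theorem expand_two_quartic (a b : ℝ) : expand ℝ 2 (quartic a b 0 0) = quartic 0 a 0 b := by
  simp only [quartic, map_add, map_mul, map_zero, map_pow, expand_C, expand_X, map_one]
  ring

namespace IsSupportEndo

variable {Θ : ℝ[X] → ℝ[X]}

theorem exists_quartic (H : IsSupportEndo Θ) {a b c e : ℝ} (ha : 0 ≤ a) (hb : 0 ≤ b) (hc : 0 ≤ c)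
    (he : 0 ≤ e) : ∃ a' b' c' e', Θ (quartic a b c e) = quartic a' b' c' e' ∧
      (0 ≤ a' ∧ 0 ≤ b' ∧ 0 ≤ c' ∧ 0 ≤ e') ∧
      (a' = 0 ↔ a = 0) ∧ (b' = 0 ↔ b = 0) ∧ (c' = 0 ↔ c = 0) ∧ (e' = 0 ↔ e = 0) := by
  have hN := normalizedNonneg_quartic ha hb hc he
  have h0 := H.normalized _ hN
  have hz := H.coeff_eq_zero _ hN
  refine ⟨_, _, _, _, ?_, ⟨h0.2 1, h0.2 2, h0.2 3, h0.2 4⟩, ?_, ?_, ?_, ?_⟩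
  · ext n
    rw [coeff_quartic]
    split_ifs with i0 i1 i2 i3 i4
    · rw [i0, h0.1]
    · rw [i1]
    · rw [i2]
    · rw [i3]
    · rw [i4]
    · rw [hz, coeff_quartic]
      simp [*]
  all_goals rw [hz, coeff_quartic]; simp

theorem exists_linear (H : IsSupportEndo Θ) {a : ℝ} (ha : 0 < a) :
    ∃ a', 0 < a' ∧ Θ (quartic a 0 0 0) = quartic a' 0 0 0 := by
  obtain ⟨a', b', c', e', h, ⟨h1, -⟩, hz1, hz2, hz3, hz4⟩ :=
    H.exists_quartic ha.le le_rfl le_rfl le_rfl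
  obtain rfl := hz2.2 rfl
  obtain rfl := hz3.2 rfl
  obtain rfl := hz4.2 rfl
  exact ⟨a', h1.lt_of_ne' (mt hz1.1 ha.ne'), h⟩

/-- The image of `(1 - b X + b c X²) (1 + b X)` is determined by the images of `1 + b X` and
`1 + c X`. -/
theorem map_cubic (H : IsSupportEndo Θ) {b c A B : ℝ} (hb : 0 < b) (hbc : b < c)
    (hΘb : Θ (quartic b 0 0 0) = quartic A 0 0 0) (hΘc : Θ (quartic c 0 0 0) = quartic B 0 0 0) :
    A < B ∧ Θ (quartic 0 (b * c - b ^ 2) (b ^ 2 * c) 0) =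
      quartic 0 (A * B - A ^ 2) (A ^ 2 * B) 0 := by
  have hc : 0 < c := hb.trans hbc
  have p1 : 0 ≤ b * c - b ^ 2 := by nlinarith
  have p2 : 0 ≤ b ^ 2 * c := by positivity
  have p3 : 0 ≤ c - b := by linarith
  have p4 : 0 ≤ b * c ^ 2 := by positivity
  obtain ⟨M0, M, N, M4, h, -, hz1, -, -, hz4⟩ := H.exists_quartic le_rfl p1 p2 le_rfl
  obtain ⟨S, T2, T, T4, h', ⟨hS, -⟩, hw1, hw2, -, hw4⟩ := H.exists_quartic p3 le_rfl p4 le_rfl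
  obtain rfl := hz1.2 rfl
  obtain rfl := hz4.2 rfl
  obtain rfl := hw2.2 rfl
  obtain rfl := hw4.2 rfl
  replace hS := hS.lt_of_ne' (mt hw1.1 (by linarith))
  have hmul : quartic 0 (b * c - b ^ 2) (b ^ 2 * c) 0 * quartic c 0 0 0 =
      quartic (c - b) 0 (b * c ^ 2) 0 * quartic b 0 0 0 := by
    simp only [quartic, C_mul, map_zero, map_sub, map_pow]
    ring
  replace hmul := congrArg Θ hmul
  rw [H.map_mul _ _ (normalizedNonneg_quartic le_rfl p1 p2 le_rfl)
      (normalizedNonneg_quartic hc.le le_rfl le_rfl le_rfl),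
    H.map_mul _ _ (normalizedNonneg_quartic p3 le_rfl p4 le_rfl)
      (normalizedNonneg_quartic hb.le le_rfl le_rfl le_rfl), h, h', hΘb, hΘc] at hmul
  obtain ⟨e1, e2, e3, e4, -⟩ := quartic_mul_eq_quartic_mul hmul
  have hN : N = A ^ 2 * B := by
    have : S * N = S * (A ^ 2 * B) := by
      obtain rfl : S = B - A := by linarith
      linear_combination e4 - A * e3 + A * B * e2
    exact mul_left_cancel₀ hS.ne' this
  have hM : M = A * B - A ^ 2 := by
    obtain rfl : S = B - A := by linarith
    linear_combination e2
  exact ⟨by linarith, by rw [h, hM, hN]⟩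

theorem functional_equation (H : IsSupportEndo Θ) {φ : ℝ → ℝ}
    (hΘ : ∀ a, 0 < a → Θ (quartic a 0 0 0) = quartic (φ a) 0 0 0)
    {u b v w : ℝ} (hu : 0 < u) (hub : u < b) (hbv : b < v) (hw : b * w = b * (u + v) - u * v) :
    φ w * φ b = (φ u + φ v) * φ b - φ u * φ v := by
  have hb : 0 < b := hu.trans hub
  have hv : 0 < v := hb.trans hbv
  have hbw : b < w := by nlinarith
  have hw0 : 0 < w := hb.trans hbw
  obtain ⟨-, hc⟩ := H.map_cubic hb hbw (hΘ b hb) (hΘ w hw0)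
  have p1 : 0 ≤ u + v - b := by linarith
  have p2 : 0 ≤ b * w * (u + v) - b * (u * v) := by
    rw [show b * w * (u + v) - b * (u * v) = b * ((w - b) * (u + v) + b * u + (b - u) * v) by ring]
    have := sub_pos.2 hbw
    have := sub_pos.2 hub
    positivity
  have p3 : 0 ≤ b * w * (u * v) := by positivity
  obtain ⟨G, G2, G3, G4, hg, -, -, hz2, -, -⟩ := H.exists_quartic p1 le_rfl p2 p3
  obtain rfl := hz2.2 rfl
  have p4 : 0 ≤ b * w - b ^ 2 := by nlinarith
  have n1 := normalizedNonneg_quartic hu.le le_rfl le_rfl le_rfl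
  have n2 := normalizedNonneg_quartic hv.le le_rfl le_rfl le_rfl
  have n3 := normalizedNonneg_quartic hb.le le_rfl le_rfl le_rfl
  have n4 : NormalizedNonneg (quartic 0 (b * w - b ^ 2) (b ^ 2 * w) 0) :=
    normalizedNonneg_quartic le_rfl p4 (by positivity) le_rfl
  have hmul : quartic 0 (b * w - b ^ 2) (b ^ 2 * w) 0 * (quartic u 0 0 0 * quartic v 0 0 0) =
      quartic (u + v - b) 0 (b * w * (u + v) - b * (u * v)) (b * w * (u * v)) *
        quartic b 0 0 0 := by
    have hw' : (C b * C w : ℝ[X]) = C b * (C u + C v) - C u * C v := by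
      rw [← C_mul, hw]; simp
    simp only [quartic, C_mul, map_zero, map_sub, map_pow, map_add]
    linear_combination (X ^ 2 + C b * X ^ 3) * hw'
  replace hmul := congrArg Θ hmul
  rw [H.map_mul _ _ n4 (n1.mul n2), H.map_mul _ _ n1 n2,
    H.map_mul _ _ (normalizedNonneg_quartic p1 le_rfl p2 p3) n3, hΘ u hu, hΘ v hv, hΘ b hb, hc,
    hg, quartic_mul_quartic] at hmul
  obtain ⟨e1, e2, -⟩ := quartic_mul_eq_quartic_mul hmul
  linear_combination e2 - φ b * e1

theorem exists_scale (H : IsSupportEndo Θ) :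
    ∃ k, 0 < k ∧ ∀ a, 0 < a → Θ (quartic a 0 0 0) = quartic (k * a) 0 0 0 := by
  choose! φ hφ hΘ using fun a => H.exists_linear (a := a)
  obtain ⟨k, hk, hlin⟩ := linear_of_functional_equation φ hφ
    (fun a b ha hab =>
      (H.map_cubic ha hab (hΘ a ha) (hΘ b (ha.trans hab))).1)
    (fun u b v hu hub hbv => H.functional_equation hΘ hu hub hbv
      (by have := hu.trans hub; field_simp))
  exact ⟨k, hk, fun a ha => by rw [hΘ a ha, hlin a ha]⟩

theorem map_quadratic (H : IsSupportEndo Θ) {k : ℝ} (hk : 0 < k)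
    (hΘ : ∀ a, 0 < a → Θ (quartic a 0 0 0) = quartic (k * a) 0 0 0) {d e : ℝ} (hd : 0 < d)
    (he : 0 < e) : Θ (quartic d e 0 0) = quartic (k * d) (k ^ 2 * e) 0 0 := by
  have cubic : ∀ b c, 0 < b → b < c → Θ (quartic 0 (b * c - b ^ 2) (b ^ 2 * c) 0) =
      quartic 0 (k ^ 2 * (b * c - b ^ 2)) (k ^ 3 * (b ^ 2 * c)) 0 := by
    intro b c hb hbc
    have hc := hb.trans hbc
    rw [(H.map_cubic hb hbc (hΘ b hb) (hΘ c hc)).2]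
    congr 1 <;> ring
  obtain ⟨D, E, D3, D4, hT, -, -, -, hz3, hz4⟩ := H.exists_quartic hd.le he.le le_rfl le_rfl
  obtain rfl := hz3.2 rfl
  obtain rfl := hz4.2 rfl
  have nT := normalizedNonneg_quartic hd.le he.le le_rfl le_rfl
  have nL : ∀ b, 0 < b → NormalizedNonneg (quartic b 0 0 0) := fun b hb =>
    normalizedNonneg_quartic hb.le le_rfl le_rfl le_rfl
  have nC : ∀ b c, 0 < b → b < c → NormalizedNonneg (quartic 0 (b * c - b ^ 2) (b ^ 2 * c) 0) :=
    fun b c hb hbc => normalizedNonneg_quartic le_rfl (by nlinarith)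
      (mul_nonneg (sq_nonneg b) (hb.trans hbc).le) le_rfl
  have hD : D = k * d := by
    obtain ⟨c, hc, hdc⟩ : ∃ c, d < c ∧ d * c = d ^ 2 + e + d :=
      ⟨d + e / d + 1, by have := div_pos he hd; linarith, by field_simp⟩
    have p2 : 0 ≤ e - d ^ 2 + d * c := by rw [hdc]; linarith
    have p3 : 0 ≤ d * c * d - d * e := by rw [hdc]; ring_nf; positivity
    have p4 : 0 ≤ d * c * e := by rw [hdc]; positivity
    obtain ⟨G, G2, G3, G4, hg, -, hz1, -, -, -⟩ := H.exists_quartic le_rfl p2 p3 p4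
    obtain rfl := hz1.2 rfl
    have hmul : quartic 0 (d * c - d ^ 2) (d ^ 2 * c) 0 * quartic d e 0 0 =
        quartic 0 (e - d ^ 2 + d * c) (d * c * d - d * e) (d * c * e) * quartic d 0 0 0 := by
      simp only [quartic, C_mul, map_zero, map_sub, map_pow, map_add]
      ring
    replace hmul := congrArg Θ hmul
    rw [H.map_mul _ _ (nC d c hd hc) nT,
      H.map_mul _ _ (normalizedNonneg_quartic le_rfl p2 p3 p4) (nL d hd), hΘ d hd, cubic d c hd hc,
      hg, hT] at hmul
    obtain ⟨e1, -⟩ := quartic_mul_eq_quartic_mul hmul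
    linarith
  have hE : E = k ^ 2 * e := by
    obtain ⟨c, rfl⟩ : ∃ c, e = d * c := ⟨e / d, by field_simp⟩
    have hc : 0 < c := pos_of_mul_pos_right he hd.le
    obtain ⟨b, hb, hbd, hbc⟩ : ∃ b, 0 < b ∧ b < d ∧ b < c :=
      ⟨min d c / 2, half_pos (lt_min hd hc),
        (half_lt_self (lt_min hd hc)).trans_le (min_le_left _ _),
        (half_lt_self (lt_min hd hc)).trans_le (min_le_right _ _)⟩
    have p1 : 0 ≤ d - b := by linarith
    have p2 : 0 ≤ d * c - b * d + b * c := by nlinarith [mul_pos hb hc]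
    have p4 : 0 ≤ b * c * (d * c) := by positivity
    obtain ⟨G, G2, G3, G4, hg, -, -, -, hz3, -⟩ := H.exists_quartic p1 p2 le_rfl p4
    obtain rfl := hz3.2 rfl
    have hmul : quartic 0 (b * c - b ^ 2) (b ^ 2 * c) 0 * quartic d (d * c) 0 0 =
        quartic (d - b) (d * c - b * d + b * c) 0 (b * c * (d * c)) * quartic b 0 0 0 := by
      simp only [quartic, C_mul, map_zero, map_sub, map_pow, map_add]
      ring
    replace hmul := congrArg Θ hmul
    rw [H.map_mul _ _ (nC b c hb hbc) nT,
      H.map_mul _ _ (normalizedNonneg_quartic p1 p2 le_rfl p4) (nL b hb), hΘ b hb, cubic b c hb hbc,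
      hg, hT, hD] at hmul
    obtain ⟨-, -, -, e4, e5⟩ := quartic_mul_eq_quartic_mul hmul
    have hne : k ^ 3 * b ^ 3 ≠ 0 := by positivity
    apply mul_left_cancel₀ hne
    linear_combination e5 - k * b * e4
  rw [hT, hD, hE]

theorem expand_contract_map_expand (H : IsSupportEndo Θ) {f : ℝ[X]} (hf : NormalizedNonneg f) :
    expand ℝ 2 (contract 2 (Θ (expand ℝ 2 f))) = Θ (expand ℝ 2 f) := by
  ext i
  rw [coeff_expand two_pos]
  split_ifs with h
  · rw [coeff_contract two_ne_zero, Nat.div_mul_cancel h]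
  · rw [eq_comm, H.coeff_eq_zero _ (hf.expand two_pos), coeff_expand two_pos, if_neg h]

/-- The endomorphism induced on polynomials in `X ^ 2`. -/
theorem contract_two (H : IsSupportEndo Θ) :
    IsSupportEndo fun f => contract 2 (Θ (expand ℝ 2 f)) where
  normalized f hf := by
    have := H.normalized _ (hf.expand two_pos)
    exact ⟨by rw [coeff_contract two_ne_zero]; exact this.1, fun i => by
      rw [coeff_contract two_ne_zero]; exact this.2 _⟩
  coeff_eq_zero f hf i := by
    rw [coeff_contract two_ne_zero, H.coeff_eq_zero _ (hf.expand two_pos),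
      coeff_expand_mul two_pos]
  map_mul f g hf hg := by
    apply expand_injective two_pos
    rw [H.expand_contract_map_expand (hf.mul hg), _root_.map_mul, _root_.map_mul,
      H.expand_contract_map_expand hf, H.expand_contract_map_expand hg,
      H.map_mul _ _ (hf.expand two_pos) (hg.expand two_pos)]

theorem contract_two_linear (H : IsSupportEndo Θ) {k : ℝ} (hk : 0 < k)
    (hΘ : ∀ a, 0 < a → Θ (quartic a 0 0 0) = quartic (k * a) 0 0 0) {a : ℝ} (ha : 0 < a) :
    contract 2 (Θ (expand ℝ 2 (quartic a 0 0 0))) = quartic (k ^ 2 * a) 0 0 0 := by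
  obtain ⟨l, hl, hlin⟩ := H.contract_two.exists_scale
  suffices l = k ^ 2 by rw [← this]; exact hlin a ha
  have nq : NormalizedNonneg (quartic 1 1 0 0) :=
    normalizedNonneg_quartic zero_le_one zero_le_one le_rfl le_rfl
  have hq := H.contract_two.map_quadratic hl hlin one_pos one_pos
  replace hq : expand ℝ 2 (contract 2 (Θ (expand ℝ 2 (quartic 1 1 0 0)))) = _ :=
    congrArg (expand ℝ 2) hq
  rw [H.expand_contract_map_expand nq, expand_two_quartic, expand_two_quartic] at hq
  have n1 : NormalizedNonneg (quartic 0 1 0 1) :=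
    normalizedNonneg_quartic le_rfl zero_le_one le_rfl zero_le_one
  have n2 : NormalizedNonneg (quartic 1 0 0 0) :=
    normalizedNonneg_quartic zero_le_one le_rfl le_rfl le_rfl
  have n3 : NormalizedNonneg (quartic 0 0 1 0) :=
    normalizedNonneg_quartic le_rfl le_rfl zero_le_one le_rfl
  obtain ⟨S, S2, M, S4, h, -, hz1, hz2, -, hz4⟩ :=
    H.exists_quartic le_rfl le_rfl zero_le_one le_rfl
  obtain rfl := hz1.2 rfl
  obtain rfl := hz2.2 rfl
  obtain rfl := hz4.2 rfl
  have hmul : quartic 0 1 0 1 * quartic 1 0 0 0 = quartic 0 0 1 0 * quartic 1 1 0 0 := by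
    simp only [quartic, C_1, C_0]
    ring
  replace hmul := congrArg Θ hmul
  rw [H.map_mul _ _ n1 n2, H.map_mul _ _ n3 nq, hq, h, hΘ 1 one_pos,
    H.map_quadratic hk hΘ one_pos one_pos] at hmul
  obtain ⟨-, e2, -⟩ := quartic_mul_eq_quartic_mul hmul
  linarith

end IsSupportEndo

/-- `Θ` acts on the normalized nonnegative polynomial `f` by `X ↦ k X`. -/
def ScalesBy (Θ : ℝ[X] → ℝ[X]) (k : ℝ) (f : ℝ[X]) : Prop :=
  NormalizedNonneg f ∧ Θ f = f.comp (C k * X)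

/-- `f` is a quotient of polynomials on which `Θ` acts by `X ↦ k X`. -/
def QuotScalesBy (Θ : ℝ[X] → ℝ[X]) (k : ℝ) (f : ℝ[X]) : Prop :=
  ∃ h, ScalesBy Θ k h ∧ ScalesBy Θ k (f * h)

theorem quartic_comp (k a b c e : ℝ) : (quartic a b c e).comp (C k * X) =
    quartic (k * a) (k ^ 2 * b) (k ^ 3 * c) (k ^ 4 * e) := by
  simp [quartic]
  ring

namespace IsSupportEndo

variable {Θ : ℝ[X] → ℝ[X]} {k : ℝ}

theorem scalesBy_mul (H : IsSupportEndo Θ) {f g : ℝ[X]} (hf : ScalesBy Θ k f)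
    (hg : ScalesBy Θ k g) : ScalesBy Θ k (f * g) :=
  ⟨hf.1.mul hg.1, by rw [H.map_mul _ _ hf.1 hg.1, hf.2, hg.2, mul_comp]⟩

theorem scalesBy_one (H : IsSupportEndo Θ) : ScalesBy Θ k 1 := by
  have n1 : NormalizedNonneg 1 :=
    ⟨coeff_one_zero, fun i => by rw [coeff_one]; split_ifs <;> norm_num⟩
  refine ⟨n1, ?_⟩
  have h := H.map_mul 1 1 n1 n1
  rw [mul_one] at h
  rw [one_comp]
  exact mul_left_cancel₀ (H.normalized _ n1).ne_zero (by rw [mul_one, ← h])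

theorem quotScalesBy_of_scalesBy (H : IsSupportEndo Θ) {f : ℝ[X]} (hf : ScalesBy Θ k f) :
    QuotScalesBy Θ k f :=
  ⟨1, H.scalesBy_one, by rwa [mul_one]⟩

theorem quotScalesBy_mul (H : IsSupportEndo Θ) {f g : ℝ[X]} (hf : QuotScalesBy Θ k f)
    (hg : QuotScalesBy Θ k g) : QuotScalesBy Θ k (f * g) := by
  obtain ⟨h, hh, hfh⟩ := hf
  obtain ⟨h', hh', hgh⟩ := hg
  exact ⟨h * h', H.scalesBy_mul hh hh', by
    rw [mul_mul_mul_comm]; exact H.scalesBy_mul hfh hgh⟩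

theorem scalesBy_of_quotScalesBy (H : IsSupportEndo Θ) {f : ℝ[X]} (hf : QuotScalesBy Θ k f)
    (hN : NormalizedNonneg f) : ScalesBy Θ k f := by
  obtain ⟨h, hh, hfh⟩ := hf
  refine ⟨hN, mul_right_cancel₀ (H.normalized _ hh.1).ne_zero ?_⟩
  rw [← H.map_mul _ _ hN hh.1, hfh.2, mul_comp, hh.2]

theorem scalesBy_expand_two (H : IsSupportEndo Θ) {f : ℝ[X]}
    (hf : ScalesBy (fun f => contract 2 (Θ (expand ℝ 2 f))) (k ^ 2) f) :
    ScalesBy Θ k (expand ℝ 2 f) := by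
  refine ⟨hf.1.expand two_pos, ?_⟩
  have h : contract 2 (Θ (expand ℝ 2 f)) = _ := hf.2
  rw [← H.expand_contract_map_expand hf.1, h, expand_eq_comp_X_pow, expand_eq_comp_X_pow,
    comp_assoc, comp_assoc]
  simp [mul_pow]

theorem scalesBy_linear
    (hΘ : ∀ a, 0 < a → Θ (quartic a 0 0 0) = quartic (k * a) 0 0 0) {a : ℝ} (ha : 0 < a) :
    ScalesBy Θ k (quartic a 0 0 0) :=
  ⟨normalizedNonneg_quartic ha.le le_rfl le_rfl le_rfl, by simp [hΘ a ha, quartic_comp]⟩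

theorem scalesBy_quadratic (H : IsSupportEndo Θ) (hk : 0 < k)
    (hΘ : ∀ a, 0 < a → Θ (quartic a 0 0 0) = quartic (k * a) 0 0 0) {b c : ℝ} (hb : 0 ≤ b)
    (hc : 0 < c) : ScalesBy Θ k (quartic b c 0 0) := by
  obtain rfl | hb := hb.eq_or_lt
  · rw [← expand_two_quartic]
    exact H.scalesBy_expand_two
      (scalesBy_linear (fun a ha => H.contract_two_linear hk hΘ ha) hc)
  · exact ⟨normalizedNonneg_quartic hb.le hc.le le_rfl le_rfl, by
      simp [H.map_quadratic hk hΘ hb hc, quartic_comp]⟩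

/-- Reduction of a quadratic factor by the identity
`(1 + b X + c X²) (1 - b X + c X²) = 1 + (2 c - b²) X² + c² X⁴`. -/
theorem quotScalesBy_of_contract_two (H : IsSupportEndo Θ) (hk : 0 < k)
    (hΘ : ∀ a, 0 < a → Θ (quartic a 0 0 0) = quartic (k * a) 0 0 0) {b c : ℝ} (hb : b < 0)
    (hc : 0 < c)
    (h : QuotScalesBy (fun f => contract 2 (Θ (expand ℝ 2 f))) (k ^ 2)
      (quartic (2 * c - b ^ 2) (c ^ 2) 0 0)) : QuotScalesBy Θ k (quartic b c 0 0) := by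
  obtain ⟨g, hg, hfg⟩ := h
  refine ⟨quartic (-b) c 0 0 * expand ℝ 2 g,
    H.scalesBy_mul (H.scalesBy_quadratic hk hΘ (by linarith) hc) (H.scalesBy_expand_two hg), ?_⟩
  have e : quartic b c 0 0 * quartic (-b) c 0 0 =
      expand ℝ 2 (quartic (2 * c - b ^ 2) (c ^ 2) 0 0) := by
    rw [expand_two_quartic]
    simp only [quartic, C_mul, C_neg, C_sub, C_pow, C_0]
    rw [show (C 2 : ℝ[X]) = 2 from rfl]
    ring
  rw [← mul_assoc, e, ← _root_.map_mul]
  exact H.scalesBy_expand_two hfg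

theorem quotScalesBy_quadratic_of_le (n : ℕ) : ∀ {Θ : ℝ[X] → ℝ[X]} {k : ℝ},
    IsSupportEndo Θ → 0 < k → (∀ a, 0 < a → Θ (quartic a 0 0 0) = quartic (k * a) 0 0 0) →
    ∀ {b c : ℝ}, 0 < c → b ^ 2 < 4 * c → 2 * c ≤ 2 ^ n * (4 * c - b ^ 2) →
      QuotScalesBy Θ k (quartic b c 0 0) := by
  induction n with
  | zero =>
    intro Θ k H hk hΘ b c hc _ hn
    obtain hb | hb := le_or_gt 0 b
    · exact H.quotScalesBy_of_scalesBy (H.scalesBy_quadratic hk hΘ hb hc)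
    refine H.quotScalesBy_of_contract_two hk hΘ hb hc (H.contract_two.quotScalesBy_of_scalesBy
      (H.contract_two.scalesBy_quadratic (by positivity)
        (fun a ha => H.contract_two_linear hk hΘ ha) (by linarith) (by positivity)))
  | succ n ih =>
    intro Θ k H hk hΘ b c hc hbc hn
    obtain hb | hb := le_or_gt 0 b
    · exact H.quotScalesBy_of_scalesBy (H.scalesBy_quadratic hk hΘ hb hc)
    refine H.quotScalesBy_of_contract_two hk hΘ hb hc ?_
    have hlin := fun a ha => H.contract_two_linear hk hΘ (a := a) ha
    obtain hle | hlt := le_or_gt (b ^ 2) (2 * c)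
    · exact H.contract_two.quotScalesBy_of_scalesBy
        (H.contract_two.scalesBy_quadratic (by positivity) hlin (by linarith) (by positivity))
    refine ih H.contract_two (by positivity) hlin (by positivity) ?_ ?_
    · nlinarith
    · have hD : 0 < 2 ^ n * (4 * c - b ^ 2) := mul_pos (by positivity) (by linarith)
      rw [pow_succ] at hn
      rw [show 2 ^ n * (4 * c ^ 2 - (2 * c - b ^ 2) ^ 2) = b ^ 2 * (2 ^ n * (4 * c - b ^ 2)) by
        ring]
      nlinarith

theorem quotScalesBy_quadratic (H : IsSupportEndo Θ) (hk : 0 < k)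
    (hΘ : ∀ a, 0 < a → Θ (quartic a 0 0 0) = quartic (k * a) 0 0 0) {b c : ℝ} (hc : 0 < c)
    (hbc : b ^ 2 < 4 * c) : QuotScalesBy Θ k (quartic b c 0 0) := by
  have hD : 0 < 4 * c - b ^ 2 := by linarith
  obtain ⟨n, hn⟩ := pow_unbounded_of_one_lt (2 * c / (4 * c - b ^ 2)) one_lt_two
  rw [div_lt_iff₀ hD] at hn
  exact quotScalesBy_quadratic_of_le n H hk hΘ hc hbc hn.le

theorem quotScalesBy_of_irreducible (H : IsSupportEndo Θ) (hk : 0 < k)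
    (hΘ : ∀ a, 0 < a → Θ (quartic a 0 0 0) = quartic (k * a) 0 0 0) {f : ℝ[X]}
    (hirr : Irreducible f) (h0 : f.coeff 0 = 1) (hf : ∀ x, 0 < x → f.eval x ≠ 0) :
    QuotScalesBy Θ k f := by
  have hdeg := hirr.degree_le_two
  obtain ⟨a, b, rfl⟩ : ∃ a b, f = quartic a b 0 0 := by
    refine ⟨f.coeff 1, f.coeff 2, ?_⟩
    conv_lhs => rw [eq_quadratic_of_degree_le_two hdeg, h0]
    simp only [quartic, C_0, C_1]
    ring
  have heval : ∀ x, (quartic a b 0 0).eval x = 1 + a * x + b * x ^ 2 := fun x => by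
    simp [quartic]
  obtain rfl | hb := eq_or_ne b 0
  · have ha : a ≠ 0 := by
      rintro rfl
      refine hirr.not_isUnit ?_
      simp [quartic]
    refine H.quotScalesBy_of_scalesBy (scalesBy_linear hΘ (ha.lt_or_gt.resolve_left fun h => ?_))
    refine hf (-a⁻¹) (by simpa using h) ?_
    rw [heval]
    field_simp
    ring
  · have hroot : ∀ x, 1 + a * x + b * x ^ 2 ≠ 0 := by
      intro x hx
      have h1 := degree_eq_one_of_irreducible_of_root hirr (x := x) (by rw [IsRoot, heval, hx])
      have h2 : (quartic a b 0 0).coeff 2 = 0 :=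
        coeff_eq_zero_of_degree_lt (by rw [h1]; norm_num)
      exact hb (by simpa [coeff_quartic] using h2)
    have hdisc : a ^ 2 < 4 * b := by
      by_contra! hle
      refine hroot ((-a + √(a ^ 2 - 4 * b)) / (2 * b)) ?_
      field_simp
      have := Real.sq_sqrt (sub_nonneg.2 hle)
      linear_combination this
    exact H.quotScalesBy_quadratic hk hΘ (by nlinarith [sq_nonneg a]) hdisc

theorem quotScalesBy_of_pos (H : IsSupportEndo Θ) (hk : 0 < k)
    (hΘ : ∀ a, 0 < a → Θ (quartic a 0 0 0) = quartic (k * a) 0 0 0) (f : ℝ[X])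
    (h0 : f.coeff 0 = 1) (hf : ∀ x, 0 < x → f.eval x ≠ 0) : QuotScalesBy Θ k f := by
  induction hn : f.natDegree using Nat.strong_induction_on generalizing f with
  | _ n ih =>
  obtain hdeg | hdeg := Nat.eq_zero_or_pos f.natDegree
  · rw [eq_C_of_natDegree_eq_zero hdeg, h0, C_1]
    exact H.quotScalesBy_of_scalesBy H.scalesBy_one
  obtain ⟨g, hirr, h, rfl⟩ := exists_irreducible_of_natDegree_pos hdeg
  rw [mul_coeff_zero] at h0
  have hg0 : g.coeff 0 ≠ 0 := left_ne_zero_of_mul_eq_one h0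
  have hh0 : h.coeff 0 ≠ 0 := right_ne_zero_of_mul_eq_one h0
  have hfac : g * h = (C (h.coeff 0) * g) * (C (g.coeff 0) * h) := by
    rw [mul_mul_mul_comm, ← C_mul, mul_comm (h.coeff 0), h0, C_1, one_mul]
  have hev : ∀ x, 0 < x → g.eval x ≠ 0 ∧ h.eval x ≠ 0 := fun x hx => by
    have := hf x hx
    rwa [eval_mul, mul_ne_zero_iff] at this
  rw [hfac]
  refine H.quotScalesBy_mul (H.quotScalesBy_of_irreducible hk hΘ ?_ ?_ ?_) (ih _ ?_ _ ?_ ?_ rfl)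
  · exact (irreducible_isUnit_mul (isUnit_C.2 hh0.isUnit)).2 hirr
  · rw [coeff_C_mul, mul_comm, h0]
  · intro x hx
    rw [eval_mul, eval_C]
    exact mul_ne_zero hh0 (hev x hx).1
  · rw [natDegree_C_mul hg0, ← hn, natDegree_mul hirr.ne_zero (by rintro rfl; simp at hh0)]
    have := hirr.natDegree_pos
    omega
  · rw [coeff_C_mul, h0]
  · intro x hx
    rw [eval_mul, eval_C]
    exact mul_ne_zero hg0 (hev x hx).2

theorem exists_eq_comp (H : IsSupportEndo Θ) :
    ∃ k, 0 < k ∧ ∀ f, NormalizedNonneg f → Θ f = f.comp (C k * X) := by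
  obtain ⟨k, hk, hΘ⟩ := H.exists_scale
  refine ⟨k, hk, fun f hf => (H.scalesBy_of_quotScalesBy
    (H.quotScalesBy_of_pos hk hΘ f hf.1 fun x hx => ?_) hf).2⟩
  rw [eval_eq_sum_range]
  refine (Finset.sum_pos' (fun i _ => mul_nonneg (hf.2 i) (pow_nonneg hx.le i))
    ⟨0, by simp, by simp [hf.1]⟩).ne'

end IsSupportEndo

/-- The function on `ℚ` carrying the coefficients of `f` on the multiples `0, d, 2 d, …`. -/
noncomputable def latticeFun (d : ℚ) (f : ℝ[X]) : ℚ → ℝ :=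
  Function.extend (fun i : ℕ => (i : ℚ) * d) f.coeff 0

theorem injective_natCast_mul {d : ℚ} (hd : 0 < d) :
    Function.Injective fun i : ℕ => (i : ℚ) * d := fun i j h => by
  simpa [hd.ne'] using h

theorem latticeFun_natCast_mul {d : ℚ} (hd : 0 < d) (f : ℝ[X]) (i : ℕ) :
    latticeFun d f (i * d) = f.coeff i :=
  (injective_natCast_mul hd).extend_apply f.coeff 0 i

theorem exists_of_latticeFun_ne_zero {d : ℚ} {f : ℝ[X]} {q : ℚ} (h : latticeFun d f q ≠ 0) :
    ∃ i : ℕ, (i : ℚ) * d = q := by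
  by_contra h'
  exact h (Function.extend_apply' _ _ _ h')

theorem latticeFun_injective {d : ℚ} (hd : 0 < d) : Function.Injective (latticeFun d) :=
  fun f g h => by
    ext i
    rw [← latticeFun_natCast_mul hd, h, latticeFun_natCast_mul hd]

theorem support_latticeFun_subset {d : ℚ} (hd : 0 < d) (f : ℝ[X]) :
    Function.support (latticeFun d f) ⊆ f.support.image fun i : ℕ => (i : ℚ) * d := by
  intro q hq
  obtain ⟨i, rfl⟩ := exists_of_latticeFun_ne_zero hq
  rw [Function.mem_support, latticeFun_natCast_mul hd] at hq
  exact Finset.mem_coe.2 (Finset.mem_image_of_mem _ (mem_support_iff.2 hq))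

theorem finsum_latticeFun {d : ℚ} (hd : 0 < d) (f : ℝ[X]) :
    ∑ᶠ q, latticeFun d f q = f.eval 1 := by
  rw [finsum_eq_sum_of_support_subset _ (support_latticeFun_subset hd f),
    Finset.sum_image (injective_natCast_mul hd).injOn, eval_eq_sum, sum_def]
  simp [latticeFun_natCast_mul hd]

theorem latticeFun_mem_PQmeas {d : ℚ} (hd : 0 < d) {f : ℝ[X]} (hf : ∀ i, 0 ≤ f.coeff i)
    (h1 : f.eval 1 = 1) : latticeFun d f ∈ PQmeas := by
  refine ⟨(Finset.finite_toSet _).subset (support_latticeFun_subset hd f), fun q => ?_,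
    (finsum_latticeFun hd f).trans h1⟩
  by_contra! h
  obtain ⟨i, rfl⟩ := exists_of_latticeFun_ne_zero h.ne
  rw [latticeFun_natCast_mul hd] at h
  exact (hf i).not_gt h

theorem convQ_latticeFun {d : ℚ} (hd : 0 < d) (f g : ℝ[X]) :
    convQ (latticeFun d f) (latticeFun d g) = latticeFun d (f * g) := by
  funext q
  by_cases hq : ∃ n : ℕ, (n : ℚ) * d = q
  · obtain ⟨n, rfl⟩ := hq
    have hs : (Function.support fun t => latticeFun d f t * latticeFun d g (n * d - t)) ⊆
        (Finset.HasAntidiagonal.antidiagonal n).image fun p : ℕ × ℕ => (p.1 : ℚ) * d := by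
      intro t ht
      rw [Function.mem_support] at ht
      obtain ⟨i, rfl⟩ := exists_of_latticeFun_ne_zero (left_ne_zero_of_mul ht)
      obtain ⟨j, hj⟩ := exists_of_latticeFun_ne_zero (right_ne_zero_of_mul ht)
      have hij : i + j = n := injective_natCast_mul hd (by push_cast; linarith)
      exact Finset.mem_coe.2 <| Finset.mem_image.2
        ⟨(i, j), Finset.HasAntidiagonal.mem_antidiagonal.2 hij, rfl⟩
    rw [convQ, finsum_eq_sum_of_support_subset _ hs, Finset.sum_image, latticeFun_natCast_mul hd,
      coeff_mul]
    · refine Finset.sum_congr rfl fun p hp => ?_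
      rw [latticeFun_natCast_mul hd, ← Finset.HasAntidiagonal.mem_antidiagonal.1 hp,
        show ((p.1 + p.2 : ℕ) : ℚ) * d - p.1 * d = p.2 * d by push_cast; ring,
        latticeFun_natCast_mul hd]
    · intro p hp p' hp' h
      have h1 : p.1 = p'.1 := injective_natCast_mul hd h
      have h2 := Finset.HasAntidiagonal.mem_antidiagonal.1 (Finset.mem_coe.1 hp)
      have h3 := Finset.HasAntidiagonal.mem_antidiagonal.1 (Finset.mem_coe.1 hp')
      exact Prod.ext h1 (by omega)
  · have hz : latticeFun d (f * g) q = 0 := by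
      by_contra h
      exact hq (exists_of_latticeFun_ne_zero h)
    rw [hz]
    refine finsum_eq_zero_of_forall_eq_zero fun t => ?_
    by_contra ht
    obtain ⟨i, rfl⟩ := exists_of_latticeFun_ne_zero (left_ne_zero_of_mul ht)
    obtain ⟨j, hj⟩ := exists_of_latticeFun_ne_zero (right_ne_zero_of_mul ht)
    exact hq ⟨i + j, by push_cast; linarith⟩

theorem exists_latticeFun_eq {d : ℚ} (hd : 0 < d) {μ : ℚ → ℝ} (hfin : (Function.support μ).Finite)
    (hμ : ∀ q, μ q ≠ 0 → ∃ i : ℕ, (i : ℚ) * d = q) : ∃ f, latticeFun d f = μ := by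
  have hS := hfin.preimage (injective_natCast_mul hd).injOn
  refine ⟨∑ i ∈ hS.toFinset, monomial i (μ (i * d)), ?_⟩
  funext q
  by_cases hq : ∃ i : ℕ, (i : ℚ) * d = q
  · obtain ⟨i, rfl⟩ := hq
    rw [latticeFun_natCast_mul hd, finsetSum_coeff]
    simp only [coeff_monomial, Finset.sum_ite_eq', Set.Finite.mem_toFinset, Set.mem_preimage,
      Function.mem_support, ite_eq_left_iff, not_not]
    exact fun h => h.symm
  · rw [latticeFun, Function.extend_apply' _ _ _ hq]
    by_contra h
    exact hq (hμ q (Ne.symm h))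

theorem convQ_single (a : ℚ) (ν : ℚ → ℝ) :
    convQ (Pi.single a 1) ν = fun q => ν (q - a) := by
  funext q
  rw [convQ, finsum_eq_single _ a]
  · simp
  · intro t ht
    simp [ht]

theorem single_mem_PQmeas (a : ℚ) : (Pi.single a 1 : ℚ → ℝ) ∈ PQmeas := by
  refine ⟨(Set.finite_singleton a).subset Pi.support_single_subset, fun q => ?_, ?_⟩
  · rw [Pi.single_apply]; split_ifs <;> norm_num
  · rw [finsum_eq_single _ a fun t ht => by simp [ht]]
    simp

theorem translate_mem_PQmeas {μ : ℚ → ℝ} (hμ : μ ∈ PQmeas) (a : ℚ) :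
    (fun q => μ (q + a)) ∈ PQmeas :=
  ⟨hμ.1.preimage (add_left_injective a).injOn, fun _ => hμ.2.1 _,
    (finsum_comp_equiv (Equiv.addRight a)).trans hμ.2.2⟩

theorem exists_common_denominator (S : Finset ℚ) :
    ∃ N : ℕ, 0 < N ∧ ∀ q ∈ S, ∃ z : ℤ, q = z / N := by
  refine ⟨∏ q ∈ S, q.den, Finset.prod_pos fun _ _ => Rat.den_pos _, fun q hq => ?_⟩
  obtain ⟨m, hm⟩ := Finset.dvd_prod_of_mem Rat.den hq
  have hne : (∏ q ∈ S, q.den : ℕ) ≠ 0 := (Finset.prod_pos fun _ _ => Rat.den_pos _).ne'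
  refine ⟨q.num * m, ?_⟩
  rw [hm] at hne ⊢
  have hm0 : (m : ℚ) ≠ 0 := by exact_mod_cast right_ne_zero_of_mul hne
  push_cast
  rw [mul_div_mul_right _ _ hm0, Rat.num_div_den]

section Endomorphism

variable {Φ : (ℚ → ℝ) → (ℚ → ℝ)}

theorem map_single (hmap : ∀ μ ∈ PQmeas, Φ μ ∈ PQmeas)
    (hsupp : ∀ μ ∈ PQmeas, Function.support (Φ μ) = Function.support μ) (a : ℚ) :
    Φ (Pi.single a 1) = Pi.single a 1 := by
  have hs := hsupp _ (single_mem_PQmeas a)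
  have hz : ∀ t, t ≠ a → Φ (Pi.single a 1) t = 0 := fun t ht => by
    rw [← Function.notMem_support, hs, Function.notMem_support]
    simp [ht]
  have h1 := (hmap _ (single_mem_PQmeas a)).2.2
  rw [finsum_eq_single _ a hz] at h1
  funext t
  by_cases ht : t = a
  · rw [ht, h1, Pi.single_eq_same]
  · rw [hz t ht, Pi.single_eq_of_ne ht]

theorem exists_scale_on_lattice (hmap : ∀ μ ∈ PQmeas, Φ μ ∈ PQmeas)
    (hsupp : ∀ μ ∈ PQmeas, Function.support (Φ μ) = Function.support μ)
    (hconv : ∀ μ ∈ PQmeas, ∀ ν ∈ PQmeas, Φ (convQ μ ν) = convQ (Φ μ) (Φ ν))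
    {d : ℚ} (hd : 0 < d) :
    ∃ k : ℝ, 0 < k ∧ ∀ ν ∈ PQmeas, ν 0 ≠ 0 → (∀ q, ν q ≠ 0 → ∃ i : ℕ, (i : ℚ) * d = q) →
      ∃ c, ∀ i : ℕ, Φ ν (i * d) = c * (ν (i * d) * k ^ i) := by
  have hsum : ∀ f, NormalizedNonneg f → 0 < f.eval 1 := fun f hf => by
    rw [eval_eq_sum_range]
    exact Finset.sum_pos' (fun i _ => by simpa using hf.2 i) ⟨0, by simp, by simp [hf.1]⟩
  have hP : ∀ f, NormalizedNonneg f → latticeFun d (C (f.eval 1)⁻¹ * f) ∈ PQmeas := fun f hf =>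
    latticeFun_mem_PQmeas hd
      (fun i => by
        rw [coeff_C_mul]; exact mul_nonneg (inv_nonneg.2 (hsum f hf).le) (hf.2 i))
      (by rw [eval_mul, eval_C, inv_mul_cancel₀ (hsum f hf).ne'])
  have hG : ∀ f, NormalizedNonneg f →
      ∃ g, latticeFun d g = Φ (latticeFun d (C (f.eval 1)⁻¹ * f)) := fun f hf =>
    exists_latticeFun_eq hd (hmap _ (hP f hf)).1 fun q hq => by
      rw [← Function.mem_support, hsupp _ (hP f hf)] at hq
      exact exists_of_latticeFun_ne_zero hq
  choose! G hG using hG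
  have hnn : ∀ f, NormalizedNonneg f → ∀ i, 0 ≤ (G f).coeff i := fun f hf i => by
    rw [← latticeFun_natCast_mul hd, hG f hf]
    exact (hmap _ (hP f hf)).2.1 _
  have hzero : ∀ f, NormalizedNonneg f → ∀ i, (G f).coeff i = 0 ↔ f.coeff i = 0 := fun f hf i => by
    rw [← latticeFun_natCast_mul hd, hG f hf, ← Function.notMem_support, hsupp _ (hP f hf),
      Function.notMem_support, latticeFun_natCast_mul hd, coeff_C_mul,
      mul_eq_zero_iff_left (inv_ne_zero (hsum f hf).ne')]
  have hG0 : ∀ f, NormalizedNonneg f → 0 < (G f).coeff 0 := fun f hf =>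
    (hnn f hf 0).lt_of_ne' fun h => by simpa [hf.1] using (hzero f hf 0).1 h
  have hGmul : ∀ f g, NormalizedNonneg f → NormalizedNonneg g → G (f * g) = G f * G g := by
    intro f g hf hg
    apply latticeFun_injective hd
    rw [hG _ (hf.mul hg), ← convQ_latticeFun hd (G f), hG f hf, hG g hg,
      ← hconv _ (hP f hf) _ (hP g hg), convQ_latticeFun hd, eval_mul, mul_inv, C_mul,
      mul_mul_mul_comm]
  have H : IsSupportEndo fun f => C ((G f).coeff 0)⁻¹ * G f :=
    { normalized := fun f hf => ⟨by rw [coeff_C_mul, inv_mul_cancel₀ (hG0 f hf).ne'], fun i => by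
        rw [coeff_C_mul]; exact mul_nonneg (inv_nonneg.2 (hG0 f hf).le) (hnn f hf i)⟩
      coeff_eq_zero := fun f hf i => by
        rw [coeff_C_mul, mul_eq_zero_iff_left (inv_ne_zero (hG0 f hf).ne'), hzero f hf]
      map_mul := fun f g hf hg => by
        rw [hGmul f g hf hg, mul_coeff_zero, mul_inv, C_mul, mul_mul_mul_comm] }
  obtain ⟨k, hk, hcomp⟩ := H.exists_eq_comp
  refine ⟨k, hk, fun ν hν hν0 hνd => ?_⟩
  obtain ⟨f, rfl⟩ := exists_latticeFun_eq hd hν.1 hνd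
  have hf1 : f.eval 1 = 1 := by rw [← finsum_latticeFun hd]; exact hν.2.2
  have hf0 : f.coeff 0 ≠ 0 := by
    rw [← latticeFun_natCast_mul hd]; simpa using hν0
  have hfnn : ∀ i, 0 ≤ f.coeff i := fun i => by
    rw [← latticeFun_natCast_mul hd]; exact hν.2.1 _
  set f' := C (f.coeff 0)⁻¹ * f with hf'
  have hN : NormalizedNonneg f' := ⟨by rw [hf', coeff_C_mul, inv_mul_cancel₀ hf0], fun i => by
    rw [hf', coeff_C_mul]; exact mul_nonneg (inv_nonneg.2 (hfnn 0)) (hfnn i)⟩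
  have hPf : C (f'.eval 1)⁻¹ * f' = f := by
    rw [hf', eval_mul, eval_C, hf1, mul_one, inv_inv, ← mul_assoc, ← C_mul, mul_inv_cancel₀ hf0,
      C_1, one_mul]
  refine ⟨(G f').coeff 0 * (f.coeff 0)⁻¹, fun i => ?_⟩
  have h := congrArg (fun p => coeff p i) (hcomp f' hN)
  simp only [comp_C_mul_X_coeff, coeff_C_mul] at h
  rw [hf', coeff_C_mul, ← hf'] at h
  rw [inv_mul_eq_iff_eq_mul₀ (hG0 f' hN).ne'] at h
  have hΦ := hG f' hN
  rw [hPf] at hΦ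
  rw [← hΦ, latticeFun_natCast_mul hd, latticeFun_natCast_mul hd, h]
  ring

end Endomorphism

theorem stmt_3 (Φ : (ℚ → ℝ) → (ℚ → ℝ))
    (hmap : ∀ μ ∈ PQmeas, Φ μ ∈ PQmeas)
    (hsupp : ∀ μ ∈ PQmeas, Function.support (Φ μ) = Function.support μ)
    (hconv : ∀ μ ∈ PQmeas, ∀ ν ∈ PQmeas, Φ (convQ μ ν) = convQ (Φ μ) (Φ ν)) :
    ∃ β : ℝ, ∀ μ ∈ PQmeas, ∀ q : ℚ,
      Φ μ q = μ q * Real.exp (-β * q) / ∑ᶠ y : ℚ, μ y * Real.exp (-β * y) := by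
  choose! k hk hscale using fun (d : ℚ) (hd : 0 < d) =>
    exists_scale_on_lattice hmap hsupp hconv hd
  -- compare the scales on `ℕ` and `ℕ / N` through the uniform measure on `{0, 1}`
  have hpow : ∀ N : ℕ, 0 < N → k (1 / N) ^ N = k 1 := by
    intro N hN
    have hN' : (0 : ℚ) < N := by exact_mod_cast hN
    set f : ℝ[X] := C (1 / 2) + C (1 / 2) * X with hf
    have hc : ∀ i, f.coeff i = if i = 0 ∨ i = 1 then 1 / 2 else 0 := fun i => by
      rcases i with _ | _ | i <;> simp [hf, coeff_C, coeff_X]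
    have hν := latticeFun_mem_PQmeas one_pos (f := f)
      (fun i => by rw [hc]; split_ifs <;> norm_num) (by simp [hf]; norm_num)
    set ν := latticeFun 1 f
    have h0 : ν 0 = 1 / 2 := by
      have := latticeFun_natCast_mul one_pos f 0
      simpa [hc] using this
    have h1 : ν 1 = 1 / 2 := by
      have := latticeFun_natCast_mul one_pos f 1
      simpa [hc] using this
    obtain ⟨c, hc1⟩ := hscale 1 one_pos ν hν (by rw [h0]; norm_num) fun q hq =>
      exists_of_latticeFun_ne_zero hq
    obtain ⟨c', hc2⟩ := hscale (1 / N) (by positivity) ν hν (by rw [h0]; norm_num) fun q hq => by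
      obtain ⟨i, hi⟩ := exists_of_latticeFun_ne_zero hq
      exact ⟨i * N, by rw [← hi]; push_cast; field_simp⟩
    have e1 := hc1 0
    have e2 := hc1 1
    have e3 := hc2 0
    have e4 := hc2 N
    rw [mul_one_div_cancel hN'.ne', h1] at e4
    simp only [Nat.cast_zero, zero_mul, Nat.cast_one, mul_one, h0, h1, pow_zero, pow_one] at e1 e2 e3
    have hne : Φ ν 0 ≠ 0 := by
      rw [← Function.mem_support, hsupp ν hν, Function.mem_support, h0]; norm_num
    apply mul_left_cancel₀ hne
    linear_combination e2 - e4 + k (1 / N) ^ N * e3 - k 1 * e1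
  have hexp : ∀ N i : ℕ, 0 < N →
      k (1 / N) ^ i = Real.exp (Real.log (k 1) * ((i * (1 / N) : ℚ) : ℝ)) := by
    intro N i hN
    have hN' : (0 : ℚ) < N := by exact_mod_cast hN
    have hNr : (N : ℝ) ≠ 0 := by positivity
    rw [← hpow N hN, Real.log_pow]
    push_cast
    rw [show (N : ℝ) * Real.log (k (1 / N)) * (i * (1 / N)) = i * Real.log (k (1 / N)) by
      field_simp, Real.exp_nat_mul, Real.exp_log (hk _ (by positivity))]
  refine ⟨-Real.log (k 1), fun μ hμ => ?_⟩
  rw [neg_neg]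
  suffices ∃ c, ∀ q, Φ μ q = c * (μ q * Real.exp (Real.log (k 1) * q)) by
    obtain ⟨c, hc⟩ := this
    have h1 := (hmap μ hμ).2.2
    rw [finsum_congr hc, ← mul_finsum] at h1
    intro q
    rw [hc, eq_div_iff (right_ne_zero_of_mul_eq_one h1)]
    linear_combination (μ q * Real.exp (Real.log (k 1) * q)) * h1
  have hne : hμ.1.toFinset.Nonempty := by
    rw [Set.Finite.toFinset_nonempty, Function.support_nonempty_iff]
    rintro rfl
    simpa using hμ.2.2
  obtain ⟨a, ha, hmin⟩ := hμ.1.toFinset.exists_min_image id hne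
  obtain ⟨N, hN, hden⟩ := exists_common_denominator hμ.1.toFinset
  have hN' : (0 : ℚ) < N := by exact_mod_cast hN
  have hν := translate_mem_PQmeas hμ a
  set ν : ℚ → ℝ := fun q => μ (q + a) with hνdef
  have hlat : ∀ q, ν q ≠ 0 → ∃ i : ℕ, (i : ℚ) * (1 / N) = q := by
    intro q hq
    have hq' : q + a ∈ hμ.1.toFinset := by simpa using hq
    obtain ⟨z, hz⟩ := hden _ hq'
    obtain ⟨w, hw⟩ := hden _ ha
    have hle := hmin _ hq'
    simp only [id] at hle
    rw [hz, hw, div_le_div_iff_of_pos_right hN'] at hle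
    have hle' : w ≤ z := by exact_mod_cast hle
    refine ⟨(z - w).toNat, ?_⟩
    have : (((z - w).toNat : ℤ) : ℚ) = ((z - w : ℤ) : ℚ) := by
      rw [Int.toNat_of_nonneg (by omega)]
    rw [← Int.cast_natCast, this]
    push_cast
    rw [hw] at hz
    linear_combination -hz
  obtain ⟨c, hc⟩ := hscale (1 / N) (by positivity) ν hν (by simpa [hνdef] using ha) hlat
  have hΦν : ∀ q, Φ ν q = c * (ν q * Real.exp (Real.log (k 1) * q)) := by
    intro q
    by_cases hq : ν q = 0
    · rw [hq, zero_mul, mul_zero, ← Function.notMem_support, hsupp ν hν]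
      simpa using hq
    · obtain ⟨i, rfl⟩ := hlat q hq
      rw [hc, hexp N i hN]
  have hμν : μ = convQ (Pi.single a 1) ν := by
    rw [convQ_single]
    funext q
    simp [hνdef]
  refine ⟨c * Real.exp (-(Real.log (k 1) * a)), fun q => ?_⟩
  have hΦμ : Φ μ q = Φ ν (q - a) := by
    conv_lhs => rw [hμν, hconv _ (single_mem_PQmeas a) _ hν, map_single hmap hsupp, convQ_single]
  rw [hΦμ, hΦν]
  simp only [hνdef, sub_add_cancel]
  push_cast
  rw [mul_sub, sub_eq_add_neg, Real.exp_add]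
  ring
end

section
/- (Pólya) For every q ∈ ℳ there exists N such that for all n ≥ N, the polynomial q(x)·(x+1)^n has nonnegative coefficients; equivalently, q·((X+1)/2)^n ∈ 𝒫 for all n large enough. -/
open Polynomial

/-- `Mset` is the set of real polynomials `p` with `p(1) = 1` that are positive on the
positive reals. -/
def Mset : Set (Polynomial ℝ) := {p | p.eval 1 = 1 ∧ ∀ x : ℝ, 0 < x → 0 < p.eval x}

theorem coeff_mul_nonneg {p q : ℝ[X]} (hp : ∀ k, 0 ≤ p.coeff k) (hq : ∀ k, 0 ≤ q.coeff k)
    (k : ℕ) : 0 ≤ (p * q).coeff k := by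
  rw [coeff_mul]
  exact Finset.sum_nonneg fun i _ => mul_nonneg (hp _) (hq _)

theorem coeff_X_add_one_pow_nonneg (n k : ℕ) : 0 ≤ ((X + 1 : ℝ[X]) ^ n).coeff k := by
  rw [coeff_X_add_one_pow]
  positivity

/-- A positive definite quadratic form dominates the linear form `a + s * b` far from the
origin. -/
theorem add_mul_le_quadratic_form {r s a b : ℝ} (hrs : r ^ 2 < s) (ha : 0 ≤ a) (hb : 0 ≤ b)
    (hab : 2 * (1 + s) ^ 2 / (s - r ^ 2) ≤ a + b) :
    a + s * b ≤ a ^ 2 - 2 * r * a * b + s * b ^ 2 := by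
  have hd : 0 < s - r ^ 2 := sub_pos.2 hrs
  have hs : 0 < s := (sq_nonneg r).trans_lt hrs
  rw [div_le_iff₀ hd] at hab
  have h1 : (s - r ^ 2) * (a ^ 2 + b ^ 2) ≤ (1 + s) * (a ^ 2 - 2 * r * a * b + s * b ^ 2) := by
    nlinarith [sq_nonneg (a - r * b), sq_nonneg (s * b - r * a)]
  have h2 : (s - r ^ 2) * (a + b) ^ 2 ≤ 2 * ((s - r ^ 2) * (a ^ 2 + b ^ 2)) := by
    nlinarith [mul_nonneg hd.le (sq_nonneg (a - b))]
  have h3 : 2 * (1 + s) ^ 2 * (a + b) ≤ (s - r ^ 2) * (a + b) ^ 2 := by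
    nlinarith [mul_le_mul_of_nonneg_right hab (add_nonneg ha hb)]
  have h4 : (1 + s) * ((1 + s) * (a + b)) ≤
      (1 + s) * (a ^ 2 - 2 * r * a * b + s * b ^ 2) := by linarith
  have h5 := le_of_mul_le_mul_left h4 (by linarith)
  nlinarith [mul_nonneg hs.le ha]

theorem exists_quadratic_mul_pow_coeff_nonneg {r s : ℝ} (hrs : r ^ 2 < s) :
    ∃ n : ℕ, ∀ k, 0 ≤ ((X ^ 2 - C (2 * r) * X + C s) * (X + 1) ^ n : ℝ[X]).coeff k := by
  have hs : 0 < s := (sq_nonneg r).trans_lt hrs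
  obtain ⟨n, hn⟩ := exists_nat_ge (max (2 * (1 + s) ^ 2 / (s - r ^ 2)) (2 * r / s))
  obtain ⟨hn1, hn2⟩ := max_le_iff.1 hn
  refine ⟨n, fun k => ?_⟩
  have hexp : ((X ^ 2 - C (2 * r) * X + C s) * (X + 1) ^ n : ℝ[X]) =
      (X + 1) ^ n * X ^ 2 - C (2 * r) * ((X + 1) ^ n * X) + C s * (X + 1) ^ n := by ring
  rw [hexp]
  rcases k with _ | _ | j
  · simp [coeff_X_add_one_pow, mul_coeff_zero, hs.le]
  · rw [div_le_iff₀ hs] at hn2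
    rw [coeff_add, coeff_sub, coeff_C_mul, coeff_C_mul, coeff_mul_X, coeff_mul_X_pow',
      coeff_X_add_one_pow, coeff_X_add_one_pow]
    simp
    linarith
  · rw [coeff_add, coeff_sub, coeff_C_mul, coeff_C_mul, coeff_mul_X, coeff_mul_X_pow,
      coeff_X_add_one_pow, coeff_X_add_one_pow, coeff_X_add_one_pow]
    rcases lt_or_ge n j with h | h
    · simp [Nat.choose_eq_zero_of_lt, h, h.trans (Nat.lt_succ_self _),
        Nat.choose_eq_zero_of_lt (show n < j + 1 + 1 by omega)]
    obtain ⟨b, rfl⟩ := Nat.exists_eq_add_of_le h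
    have e0 : ((j + b + 1 : ℝ)) * (j + b).choose j = (j + b + 1).choose (j + 1) * (j + 1) := by
      exact_mod_cast Nat.add_one_mul_choose_eq (j + b) j
    have e1 : ((j + b + 2 : ℝ)) * (j + b + 1).choose (j + 1) =
        (j + b + 2).choose (j + 2) * (j + 2) := by
      exact_mod_cast Nat.add_one_mul_choose_eq (j + b + 1) (j + 1)
    have e2 : ((j + b + 1).choose (j + 1) : ℝ) =
        (j + b).choose j + (j + b).choose (j + 1) := by
      exact_mod_cast Nat.choose_succ_succ (j + b) j
    have e3 : ((j + b + 1).choose (j + 2) : ℝ) =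
        (j + b).choose (j + 1) + (j + b).choose (j + 2) := by
      exact_mod_cast Nat.choose_succ_succ (j + b) (j + 1)
    have e4 : ((j + b + 1 : ℝ)) * (j + b).choose (j + 1) =
        (j + b + 1).choose (j + 2) * (j + 2) := by
      exact_mod_cast Nat.add_one_mul_choose_eq (j + b) (j + 1)
    have e5 : ((j + b + 2).choose (j + 2) : ℝ) =
        (j + b + 1).choose (j + 1) + (j + b + 1).choose (j + 2) := by
      exact_mod_cast Nat.choose_succ_succ (j + b + 1) (j + 1)
    push_cast at hn1
    have hq := add_mul_le_quadratic_form (a := j + 2) (b := b) hrs (by positivity)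
      (by positivity) (by linarith)
    have hpos : (0 : ℝ) < (j + b + 1) * (j + b + 2) := by positivity
    refine nonneg_of_mul_nonneg_right (a := ((j + b + 1) * (j + b + 2) : ℝ)) ?_ hpos
    have hT : (0 : ℝ) ≤ (j + b + 2).choose (j + 2) := by positivity
    have key := mul_nonneg hT (sub_nonneg.2 hq)
    generalize ((j + b + 2).choose (j + 2) : ℝ) = T at *
    have f0 : ((j + b + 1) * (j + b + 2) : ℝ) * (j + b).choose j = T * (j + 2) * (j + 1) := by
      linear_combination (j + b + 2 : ℝ) * e0 + (j + 1 : ℝ) * e1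
    have g : (j + b + 2 : ℝ) * (j + b + 1).choose (j + 2) = T * b := by
      linear_combination -(j + b + 2 : ℝ) * e5 - e1
    have f1 : ((j + b + 1) * (j + b + 2) : ℝ) * (j + b).choose (j + 1) = T * (j + 2) * b := by
      linear_combination (j + b + 2 : ℝ) * e4 + (j + 2 : ℝ) * g
    have f2 : ((j + b + 1) * (j + b + 2) : ℝ) * (j + b).choose (j + 2) = T * b * (b - 1) := by
      linear_combination -((j + b + 1) * (j + b + 2) : ℝ) * e3 + (j + b + 1 : ℝ) * g - f1
    have : ((j + b + 1) * (j + b + 2) : ℝ) * ((j + b).choose j - 2 * r * (j + b).choose (j + 1)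
        + s * (j + b).choose (j + 2)) = T * ((j + 2 : ℝ) ^ 2 - 2 * r * (j + 2) * b + s * b ^ 2
          - (j + 2 + s * b)) := by
      linear_combination f0 - 2 * r * f1 + s * f2
    exact this.symm ▸ key

theorem exists_mul_pow_coeff_nonneg (q : ℝ[X]) (hq : ∀ x : ℝ, 0 < x → 0 < q.eval x) :
    ∃ n : ℕ, ∀ k, 0 ≤ (q * (X + 1) ^ n).coeff k := by
  induction hd : q.natDegree using Nat.strong_induction_on generalizing q with
  | _ d ih =>
  subst hd
  have hq0 : q ≠ 0 := by
    rintro rfl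
    simpa using hq 1 one_pos
  -- It suffices to split off a factor that satisfies the claim.
  have split_factor : ∀ f : ℝ[X], f ∣ q → 0 < f.natDegree → (∀ x : ℝ, 0 < x → 0 < f.eval x) →
      (∃ n : ℕ, ∀ k, 0 ≤ (f * (X + 1) ^ n).coeff k) →
      ∃ n : ℕ, ∀ k, 0 ≤ (q * (X + 1) ^ n).coeff k := by
    rintro f ⟨g, rfl⟩ hfd hf ⟨n, hn⟩
    have hdeg := natDegree_mul (left_ne_zero_of_mul hq0) (right_ne_zero_of_mul hq0)
    obtain ⟨m, hm⟩ := ih g.natDegree (by omega) g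
      (fun x hx => pos_of_mul_pos_right (eval_mul (R := ℝ) ▸ hq x hx) (hf x hx).le) rfl
    refine ⟨n + m, fun k => ?_⟩
    rw [pow_add, mul_mul_mul_comm]
    exact coeff_mul_nonneg hn hm k
  rcases Nat.eq_zero_or_pos q.natDegree with h0 | hpos
  · refine ⟨0, fun k => ?_⟩
    rw [eq_C_of_natDegree_eq_zero h0] at hq ⊢
    have := hq 1 one_pos
    rw [eval_C] at this
    rw [pow_zero, mul_one, coeff_C]
    split_ifs
    exacts [this.le, le_rfl]
  obtain ⟨z, hz⟩ := IsAlgClosed.exists_aeval_eq_zero ℂ q (natDegree_pos_iff_degree_pos.1 hpos).ne'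
  by_cases him : z.im = 0
  · obtain ⟨a, rfl⟩ : ∃ a : ℝ, (a : ℂ) = z := ⟨z.re, Complex.ext rfl him.symm⟩
    have ha : q.eval a = 0 := by
      have := aeval_algebraMap_apply ℂ a q
      rw [Complex.coe_algebraMap, hz, coe_aeval_eq_eval] at this
      exact_mod_cast this.symm
    have ha0 : a ≤ 0 := not_lt.1 fun h => (hq a h).ne' ha
    refine split_factor (X - C a) (dvd_iff_isRoot.2 ha) (by simp)
      (fun x hx => by simp; linarith) ⟨0, fun k => ?_⟩
    rw [pow_zero, mul_one, coeff_sub, coeff_X, coeff_C]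
    split_ifs <;> linarith
  · have hrs : z.re ^ 2 < ‖z‖ ^ 2 := by
      rw [Complex.sq_norm, Complex.normSq_apply]
      nlinarith [mul_self_pos.2 him]
    refine split_factor _ (quadratic_dvd_of_aeval_eq_zero_im_ne_zero q hz him) ?_ (fun x _ => ?_)
      (exists_quadratic_mul_pow_coeff_nonneg hrs)
    · have : (X ^ 2 - C (2 * z.re) * X + C (‖z‖ ^ 2) : ℝ[X]).natDegree = 2 := by compute_degree!
      omega
    · simp only [eval_add, eval_sub, eval_mul, eval_pow, eval_X, eval_C]
      nlinarith [sq_nonneg (x - z.re)]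

theorem stmt_5 (q : Polynomial ℝ) (hq : q ∈ Mset) :
    ∃ N : ℕ, ∀ n ≥ N, ∀ k : ℕ, 0 ≤ (q * (X + 1) ^ n).coeff k := by
  obtain ⟨N, hN⟩ := exists_mul_pow_coeff_nonneg q hq.2
  refine ⟨N, fun n hn k => ?_⟩
  obtain ⟨m, rfl⟩ := Nat.exists_eq_add_of_le hn
  rw [pow_add, ← mul_assoc]
  exact coeff_mul_nonneg hN (coeff_X_add_one_pow_nonneg m) k
end
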